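/- arXiv:2207.06274 — 5 statements merged into one kernel-verified Lean document; each statement's English description precedes it below -/
import Mathlib

section
/- Let q ∈ (1,2] and let Ω ⊆ ℝ^N be open with λ₁(Ω,s,q) > 0. Then λ₁(Ω,s,q) is simple: if u, v ∈ 𝒦(Ω) satisfy ∫_Ω |u|^q dx = ∫_Ω |v|^q dx = 1 and [u]_s² = [v]_s² = λ₁(Ω,s,q), then either u = v a.e. in ℝ^N or u = −v a.e. in ℝ^N. -/
open MeasureTheory Filter Topology
open scoped ENNReal RealInnerProductSpace

noncomputable section

abbrev Euc (N : ℕ) := EuclideanSpace ℝ (Fin N)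

/-- Gagliardo energy `[u]_s²`. -/
def gagliardo (N : ℕ) (s : ℝ) (u : Euc N → ℝ) : ℝ≥0∞ :=
  ∫⁻ x : Euc N, ∫⁻ y : Euc N, ENNReal.ofReal ((u x - u y) ^ 2 / ‖x - y‖ ^ ((N : ℝ) + 2 * s))

/-- membership in the concrete model of `𝒟^{s,2}_0(Ω)`. -/
def memK (N : ℕ) (s : ℝ) (Ω : Set (Euc N)) (u : Euc N → ℝ) : Prop :=
  Measurable u ∧ (∀ᵐ x : Euc N ∂volume, x ∉ Ω → u x = 0) ∧ gagliardo N s u < ⊤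

/-- first `q`-semilinear `s`-eigenvalue. -/
def lambda1 (N : ℕ) (s q : ℝ) (Ω : Set (Euc N)) : ℝ≥0∞ :=
  ⨅ u ∈ {u : Euc N → ℝ | memK N s Ω u ∧ (∫ x in Ω, |u x| ^ q) = 1}, gagliardo N s u

/-- nonlocal bilinear form. -/
def dform (N : ℕ) (s : ℝ) (u φ : Euc N → ℝ) : ℝ :=
  ∫ p : Euc N × Euc N, (u p.1 - u p.2) * (φ p.1 - φ p.2) / ‖p.1 - p.2‖ ^ ((N : ℝ) + 2 * s)

/-- compactness of the embedding `𝒦(Ω) ↪ L^q(Ω)`. -/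
def compactEmbed (N : ℕ) (s q : ℝ) (Ω : Set (Euc N)) : Prop :=
  ∀ u : ℕ → Euc N → ℝ, (∀ n, memK N s Ω (u n)) →
    (∃ C : ℝ≥0∞, C < ⊤ ∧ ∀ n, gagliardo N s (u n) ≤ C) →
    ∃ (σ : ℕ → ℕ) (v : Euc N → ℝ), StrictMono σ ∧
      Tendsto (fun k => ∫ x in Ω, |u (σ k) x - v x| ^ q) atTop (𝓝 0)

/-- `q`-semilinear `s`-eigenfunction with eigenvalue `lam`. -/
def isEigenfunction (N : ℕ) (s q : ℝ) (Ω : Set (Euc N)) (lam : ℝ) (u : Euc N → ℝ) : Prop :=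
  memK N s Ω u ∧ 0 < ∫ x in Ω, |u x| ^ q ∧
  ∀ φ : Euc N → ℝ, memK N s Ω φ →
    dform N s u φ
      = lam * (∫ x in Ω, |u x| ^ q) ^ ((2 - q) / q) * ∫ x in Ω, |u x| ^ (q - 2) * u x * φ x

/-- `q`-semilinear `s`-eigenvalue. -/
def isEigenvalue (N : ℕ) (s q : ℝ) (Ω : Set (Euc N)) (lam : ℝ) : Prop :=
  0 < lam ∧ ∃ u : Euc N → ℝ, isEigenfunction N s q Ω lam u

/-- free energy functional `J_Ω`. -/
def freeEnergy (N : ℕ) (s q : ℝ) (Ω : Set (Euc N)) (φ : Euc N → ℝ) : ℝ :=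
  (1 / 2) * (gagliardo N s φ).toReal - (1 / q) * ∫ x in Ω, φ x ^ q

/-- Lane–Emden density of `Ω`: minimizer of the free energy among nonnegative members of `𝒦(Ω)`. -/
def isLaneEmden (N : ℕ) (s q : ℝ) (Ω : Set (Euc N)) (w : Euc N → ℝ) : Prop :=
  memK N s Ω w ∧ (∀ᵐ x : Euc N ∂volume, 0 ≤ w x) ∧
  ∀ φ : Euc N → ℝ, memK N s Ω φ → (∀ᵐ x : Euc N ∂volume, 0 ≤ φ x) →
    freeEnergy N s q Ω w ≤ freeEnergy N s q Ω φ

/-- weak solution of the fractional Lane–Emden equation in `Ω`. -/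
def isWeakSolutionLE (N : ℕ) (s q : ℝ) (Ω : Set (Euc N)) (u : Euc N → ℝ) : Prop :=
  memK N s Ω u ∧ ∀ φ : Euc N → ℝ, memK N s Ω φ →
    dform N s u φ = ∫ x in Ω, |u x| ^ (q - 2) * u x * φ x

/-- nonlocal tail. -/
def nlTail (N : ℕ) (s : ℝ) (w : Euc N → ℝ) (x₀ : Euc N) (ρ : ℝ) : ℝ :=
  ρ ^ (2 * s) * ∫ x in (Metric.ball x₀ ρ)ᶜ, |w x| / ‖x - x₀‖ ^ ((N : ℝ) + 2 * s)

/-- The normalized `ℓ^q` norm on `ℝ²`. -/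
def powMean (q a b : ℝ) : ℝ := ((|a| ^ q + |b| ^ q) / 2) ^ (1 / q)

theorem strictConvexOn_abs_rpow {q : ℝ} (hq : 1 < q) :
    StrictConvexOn ℝ Set.univ fun x : ℝ => |x| ^ q := by
  refine ⟨convex_univ, fun x _ y _ hxy a b ha hb hab => ?_⟩
  simp only [smul_eq_mul]
  have hq0 : 0 < q := by linarith
  have htri : |a * x + b * y| ≤ a * |x| + b * |y| := by
    simpa [abs_mul, abs_of_pos ha, abs_of_pos hb] using abs_add_le (a * x) (b * y)
  by_cases h : |x| = |y|
  · have hyx : x = -y := (abs_eq_abs.mp h).resolve_left hxy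
    have hy : y ≠ 0 := by rintro rfl; simp_all
    have hlt : |a * x + b * y| < |y| := by
      rw [hyx, show a * -y + b * y = (b - a) * y by ring, abs_mul]
      have : |b - a| < 1 := by rw [abs_lt]; constructor <;> linarith
      nlinarith [abs_pos.mpr hy]
    have := Real.rpow_lt_rpow (abs_nonneg _) hlt hq0
    rw [h, ← add_mul, hab, one_mul]
    exact this
  · exact (Real.rpow_le_rpow (abs_nonneg _) htri hq0.le).trans_lt
      ((strictConvexOn_rpow hq).2 (abs_nonneg x) (abs_nonneg y) h ha hb hab)

theorem powMean_nonneg (q a b : ℝ) : 0 ≤ powMean q a b := by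
  unfold powMean; positivity

theorem powMean_rpow {q : ℝ} (hq : 0 < q) (a b : ℝ) :
    powMean q a b ^ q = (|a| ^ q + |b| ^ q) / 2 := by
  unfold powMean
  rw [← Real.rpow_mul (by positivity), one_div_mul_cancel hq.ne', Real.rpow_one]

theorem powMean_eq_zero {q : ℝ} (hq : 0 < q) {a b : ℝ} (h : powMean q a b = 0) :
    a = 0 ∧ b = 0 := by
  have h1 := powMean_rpow hq a b
  rw [h, Real.zero_rpow hq.ne'] at h1
  have ha : 0 ≤ |a| ^ q := by positivity
  have hb : 0 ≤ |b| ^ q := by positivity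
  constructor
  · have : |a| ^ q = 0 := by linarith
    simpa [Real.rpow_eq_zero_iff_of_nonneg, hq.ne'] using this
  · have : |b| ^ q = 0 := by linarith
    simpa [Real.rpow_eq_zero_iff_of_nonneg, hq.ne'] using this

theorem abs_div_powMean {q : ℝ} (hq : 0 < q) {a b : ℝ} (h : 0 < powMean q a b) :
    |a / powMean q a b| ^ q + |b / powMean q a b| ^ q = 2 := by
  have h1 := powMean_rpow hq a b
  have hp : 0 < powMean q a b ^ q := by positivity
  rw [abs_div, abs_div, abs_of_pos h, Real.div_rpow (abs_nonneg _) h.le,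
    Real.div_rpow (abs_nonneg _) h.le, ← add_div, div_eq_iff hp.ne']
  linarith

/-- Strict Minkowski inequality for non-proportional vectors of the plane, with the weak one. -/
theorem powMean_add {q : ℝ} (hq : 1 < q) (a b c d : ℝ) :
    powMean q (a + c) (b + d) ≤ powMean q a b + powMean q c d ∧
      (powMean q (a + c) (b + d) = powMean q a b + powMean q c d → a * d = b * c) := by
  have hq0 : 0 < q := by linarith
  rcases (powMean_nonneg q a b).eq_or_lt with hA | hA
  · obtain ⟨rfl, rfl⟩ := powMean_eq_zero hq0 hA.symm
    rw [← hA]; simp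
  rcases (powMean_nonneg q c d).eq_or_lt with hC | hC
  · obtain ⟨rfl, rfl⟩ := powMean_eq_zero hq0 hC.symm
    rw [← hC]; simp
  have hea := abs_div_powMean hq0 hA
  have hec := abs_div_powMean hq0 hC
  have hP := powMean_rpow hq0 (a + c) (b + d)
  have hP0 := powMean_nonneg q (a + c) (b + d)
  set A := powMean q a b
  set C := powMean q c d
  set S := powMean q (a + c) (b + d)
  have hAC : 0 < A + C := by positivity
  have hw : A / (A + C) + C / (A + C) = 1 := by field_simp
  have hwA : 0 < A / (A + C) := by positivity
  have hwC : 0 < C / (A + C) := by positivity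
  have hcomb (x y : ℝ) :
      A / (A + C) * (x / A) + C / (A + C) * (y / C) = (x + y) / (A + C) := by
    field_simp
  have hle (x y : ℝ) : |(x + y) / (A + C)| ^ q ≤
      A / (A + C) * |x / A| ^ q + C / (A + C) * |y / C| ^ q := by
    rw [← hcomb]
    exact (strictConvexOn_abs_rpow hq).convexOn.2 (Set.mem_univ _) (Set.mem_univ _)
      hwA.le hwC.le hw
  have hlt (x y : ℝ) (hxy : x / A ≠ y / C) : |(x + y) / (A + C)| ^ q <
      A / (A + C) * |x / A| ^ q + C / (A + C) * |y / C| ^ q := by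
    rw [← hcomb]
    exact (strictConvexOn_abs_rpow hq).2 (Set.mem_univ _) (Set.mem_univ _) hxy hwA hwC hw
  have hsum : |(a + c) / (A + C)| ^ q + |(b + d) / (A + C)| ^ q = 2 * (S / (A + C)) ^ q := by
    rw [abs_div, abs_div, abs_of_pos hAC, Real.div_rpow (abs_nonneg _) hAC.le,
      Real.div_rpow (abs_nonneg _) hAC.le, Real.div_rpow hP0 hAC.le, hP]
    ring
  have hrhs : A / (A + C) * |a / A| ^ q + C / (A + C) * |c / C| ^ q +
      (A / (A + C) * |b / A| ^ q + C / (A + C) * |d / C| ^ q) = 2 := by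
    linear_combination (A / (A + C)) * hea + (C / (A + C)) * hec + 2 * hw
  refine ⟨?_, fun heq => ?_⟩
  · have h1 : (S / (A + C)) ^ q ≤ 1 := by linarith [hle a c, hle b d]
    by_contra! hgt
    have : 1 < S / (A + C) := by rwa [one_lt_div hAC]
    linarith [Real.one_lt_rpow this hq0]
  · rw [heq, div_self hAC.ne', Real.one_rpow] at hsum
    have h1 : a / A = c / C := by
      by_contra hne; linarith [hlt a c hne, hle b d]
    have h2 : b / A = d / C := by
      by_contra hne; linarith [hle a c, hlt b d hne]
    rw [div_eq_div_iff hA.ne' hC.ne'] at h1 h2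
    have : A * C * (a * d) = A * C * (b * c) := by
      linear_combination (A * d) * h1 - (A * c) * h2
    exact mul_left_cancel₀ (by positivity) this

theorem powMean_sq_le {q : ℝ} (hq0 : 0 < q) (hq : q ≤ 2) (a b : ℝ) :
    powMean q a b ^ 2 ≤ (a ^ 2 + b ^ 2) / 2 := by
  have hc := (convexOn_rpow (p := 2 / q) (by rwa [le_div_iff₀ hq0, one_mul])).2
    (Set.mem_Ici.mpr (by positivity : 0 ≤ |a| ^ q))
    (Set.mem_Ici.mpr (by positivity : 0 ≤ |b| ^ q))
    (by norm_num : (0 : ℝ) ≤ 1 / 2) (by norm_num : (0 : ℝ) ≤ 1 / 2) (by norm_num)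
  simp only [smul_eq_mul] at hc
  have hpow (x : ℝ) : (|x| ^ q) ^ (2 / q) = x ^ 2 := by
    rw [← Real.rpow_mul (abs_nonneg _), mul_div_cancel₀ _ hq0.ne', Real.rpow_two, sq_abs]
  rw [hpow, hpow] at hc
  have hl : powMean q a b ^ 2 = (1 / 2 * |a| ^ q + 1 / 2 * |b| ^ q) ^ (2 / q) := by
    unfold powMean
    rw [← Real.rpow_natCast, ← Real.rpow_mul (by positivity)]
    congr 1
    · ring
    · push_cast; ring
  rw [hl]; linarith

theorem sq_powMean_sub_powMean {q : ℝ} (hq : q ∈ Set.Ioc (1 : ℝ) 2) (a b c d : ℝ) :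
    (powMean q a b - powMean q c d) ^ 2 ≤ ((a - c) ^ 2 + (b - d) ^ 2) / 2 ∧
      ((powMean q a b - powMean q c d) ^ 2 = ((a - c) ^ 2 + (b - d) ^ 2) / 2 →
        a * d = b * c) := by
  have hq1 := hq.1
  wlog h : powMean q c d ≤ powMean q a b generalizing a b c d
  · have := this c d a b (le_of_not_ge h)
    rw [show (powMean q a b - powMean q c d) ^ 2 = (powMean q c d - powMean q a b) ^ 2 by ring,
      show (a - c) ^ 2 = (c - a) ^ 2 by ring, show (b - d) ^ 2 = (d - b) ^ 2 by ring]
    exact ⟨this.1, fun e => by linarith [this.2 e]⟩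
  obtain ⟨h1, h2⟩ := powMean_add hq1 c d (a - c) (b - d)
  rw [add_sub_cancel, add_sub_cancel] at h1 h2
  have h3 := powMean_sq_le (by linarith) hq.2 (a - c) (b - d)
  have h4 := powMean_nonneg q (a - c) (b - d)
  refine ⟨by nlinarith, fun e => ?_⟩
  have h5 : powMean q (a - c) (b - d) ≤ powMean q a b - powMean q c d :=
    abs_le_of_sq_le_sq' (by linarith) (by linarith) |>.2
  linarith [h2 (by linarith)]

/-- The integrand of `gagliardo`. -/
def gagliardoDensity (N : ℕ) (s : ℝ) (u : Euc N → ℝ) (p : Euc N × Euc N) : ℝ≥0∞ :=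
  ENNReal.ofReal ((u p.1 - u p.2) ^ 2 / ‖p.1 - p.2‖ ^ ((N : ℝ) + 2 * s))

theorem measurable_gagliardoDensity {N : ℕ} {s : ℝ} {u : Euc N → ℝ} (hu : Measurable u) :
    Measurable (gagliardoDensity N s u) := by
  unfold gagliardoDensity; fun_prop

theorem gagliardo_eq_lintegral {N : ℕ} {s : ℝ} {u : Euc N → ℝ} (hu : Measurable u) :
    gagliardo N s u = ∫⁻ p, gagliardoDensity N s u p ∂(volume.prod volume) := by
  rw [lintegral_prod _ (measurable_gagliardoDensity hu).aemeasurable]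
  rfl

theorem gagliardoDensity_powMean_le {N : ℕ} {s q : ℝ} (hq : q ∈ Set.Ioc (1 : ℝ) 2)
    (u v : Euc N → ℝ) (p : Euc N × Euc N) :
    gagliardoDensity N s (fun x => powMean q (u x) (v x)) p ≤
      ENNReal.ofReal (((u p.1 - u p.2) ^ 2 + (v p.1 - v p.2) ^ 2) / 2 /
        ‖p.1 - p.2‖ ^ ((N : ℝ) + 2 * s)) := by
  unfold gagliardoDensity
  gcongr
  exact (sq_powMean_sub_powMean hq _ _ _ _).1

theorem lintegral_mean_gagliardoDensity {N : ℕ} {s : ℝ} {u v : Euc N → ℝ}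
    (hu : Measurable u) (hv : Measurable v) :
    ∫⁻ p : Euc N × Euc N, ENNReal.ofReal (((u p.1 - u p.2) ^ 2 + (v p.1 - v p.2) ^ 2) / 2 /
        ‖p.1 - p.2‖ ^ ((N : ℝ) + 2 * s)) ∂(volume.prod volume) =
      2⁻¹ * (gagliardo N s u + gagliardo N s v) := by
  rw [gagliardo_eq_lintegral hu, gagliardo_eq_lintegral hv,
    ← lintegral_add_left (measurable_gagliardoDensity hu),
    ← lintegral_const_mul _
      (by exact (measurable_gagliardoDensity hu).add (measurable_gagliardoDensity hv))]
  refine lintegral_congr fun p => ?_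
  unfold gagliardoDensity
  rw [← ENNReal.ofReal_add (by positivity) (by positivity),
    show (2⁻¹ : ℝ≥0∞) = ENNReal.ofReal 2⁻¹ by
      rw [ENNReal.ofReal_inv_of_pos two_pos, ENNReal.ofReal_ofNat],
    ← ENNReal.ofReal_mul (by norm_num)]
  congr 1
  ring

/-- Two extremals of `lambda1` take proportional values at almost every pair of points. -/
theorem ae_mul_eq_mul_of_gagliardo_eq_lambda1 {N : ℕ} {s q : ℝ} {Ω : Set (Euc N)}
    {u v : Euc N → ℝ} (hq : q ∈ Set.Ioc (1 : ℝ) 2) (hu : memK N s Ω u) (hv : memK N s Ω v)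
    (hu1 : (∫ x in Ω, |u x| ^ q) = 1) (hv1 : (∫ x in Ω, |v x| ^ q) = 1)
    (hue : gagliardo N s u = lambda1 N s q Ω) (hve : gagliardo N s v = lambda1 N s q Ω) :
    ∀ᵐ x : Euc N ∂volume, ∀ᵐ y : Euc N ∂volume, u x * v y = v x * u y := by
  have hq0 : 0 < q := by linarith [hq.1]
  obtain ⟨hum, hu0, hut⟩ := hu
  obtain ⟨hvm, hv0, -⟩ := hv
  set w : Euc N → ℝ := fun x => powMean q (u x) (v x) with hw
  have hwm : Measurable w := by unfold w powMean; fun_prop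
  have hmean := lintegral_mean_gagliardoDensity (s := s) hum hvm
  have hle := gagliardoDensity_powMean_le (s := s) hq u v
  have htwo : 2⁻¹ * (gagliardo N s u + gagliardo N s v) = lambda1 N s q Ω := by
    rw [hue, hve, ← two_mul, ← mul_assoc, ENNReal.inv_mul_cancel two_ne_zero (by simp), one_mul]
  rw [htwo] at hmean
  have hwle : gagliardo N s w ≤ lambda1 N s q Ω := by
    rw [gagliardo_eq_lintegral hwm, ← hmean]
    exact lintegral_mono hle
  have hwK : memK N s Ω w := by
    refine ⟨hwm, ?_, hwle.trans_lt (hue ▸ hut)⟩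
    filter_upwards [hu0, hv0] with x h1 h2 hx
    simp [hw, powMean, h1 hx, h2 hx, Real.zero_rpow, hq0.ne']
  have hui : IntegrableOn (fun x => |u x| ^ q) Ω := by
    by_contra h
    rw [integral_undef h] at hu1
    exact zero_ne_one hu1
  have hvi : IntegrableOn (fun x => |v x| ^ q) Ω := by
    by_contra h
    rw [integral_undef h] at hv1
    exact zero_ne_one hv1
  have hw1 : (∫ x in Ω, |w x| ^ q) = 1 := by
    simp only [hw, abs_of_nonneg (powMean_nonneg _ _ _), powMean_rpow hq0]
    rw [integral_div, integral_add hui hvi, hu1, hv1]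
    norm_num
  have hwge : lambda1 N s q Ω ≤ gagliardo N s w := iInf₂_le w ⟨hwK, hw1⟩
  have hae := ae_eq_of_ae_le_of_lintegral_le (Eventually.of_forall hle)
    (by rw [← gagliardo_eq_lintegral hwm]; exact hwK.2.2.ne)
    (by fun_prop)
    (by rw [← gagliardo_eq_lintegral hwm, hmean]; exact hwge)
  refine Measure.ae_ae_of_ae_prod (p := fun p : Euc N × Euc N => u p.1 * v p.2 = v p.1 * u p.2) ?_
  filter_upwards [hae] with p hp
  by_cases hne : p.1 = p.2
  · rw [hne, mul_comm]
  have hpos : 0 < ‖p.1 - p.2‖ ^ ((N : ℝ) + 2 * s) :=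
    Real.rpow_pos_of_pos (norm_pos_iff.mpr (sub_ne_zero.mpr hne)) _
  unfold gagliardoDensity at hp
  rw [ENNReal.ofReal_eq_ofReal_iff (by positivity) (by positivity),
    div_left_inj' hpos.ne'] at hp
  exact (sq_powMean_sub_powMean hq _ _ _ _).2 hp

/-- simplicity of the first eigenvalue for `q ∈ (1,2]`. -/
theorem stmt_1 (N : ℕ) (hN : 1 ≤ N) (s : ℝ) (hs : s ∈ Set.Ioo (0 : ℝ) 1)
    (q : ℝ) (hq : q ∈ Set.Ioc (1 : ℝ) 2)
    (Ω : Set (Euc N)) (hΩ : IsOpen Ω) (hpos : 0 < lambda1 N s q Ω)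
    (u v : Euc N → ℝ) (hu : memK N s Ω u) (hv : memK N s Ω v)
    (hu1 : (∫ x in Ω, |u x| ^ q) = 1) (hv1 : (∫ x in Ω, |v x| ^ q) = 1)
    (hue : gagliardo N s u = lambda1 N s q Ω) (hve : gagliardo N s v = lambda1 N s q Ω) :
    (u =ᵐ[volume] v) ∨ (u =ᵐ[volume] fun x => -v x) := by
  have hq0 : 0 < q := by linarith [hq.1]
  have hprop := ae_mul_eq_mul_of_gagliardo_eq_lambda1 hq hu hv hu1 hv1 hue hve
  have hnz : ∃ᶠ x in ae volume, u x ≠ 0 := by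
    intro h
    have : (∫ x in Ω, |u x| ^ q) = 0 := by
      refine integral_eq_zero_of_ae (ae_restrict_of_ae ?_)
      filter_upwards [h] with x hx
      simp [not_not.mp hx, Real.zero_rpow, hq0.ne']
    linarith
  obtain ⟨x, hx, hxy⟩ := (hnz.and_eventually hprop).exists
  have hint : |u x| ^ q = |v x| ^ q := by
    have : (∫ y in Ω, |u x| ^ q * |v y| ^ q) = ∫ y in Ω, |v x| ^ q * |u y| ^ q := by
      refine integral_congr_ae (ae_restrict_of_ae ?_)
      filter_upwards [hxy] with y hy
      simp only [← Real.mul_rpow (abs_nonneg _) (abs_nonneg _), ← abs_mul, hy]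
    rwa [integral_const_mul, integral_const_mul, hu1, hv1, mul_one, mul_one] at this
  have habs : |u x| = |v x| := (Real.rpow_left_inj (abs_nonneg _) (abs_nonneg _) hq0.ne').mp hint
  rcases abs_eq_abs.mp habs with h | h
  · left
    filter_upwards [hxy] with y hy
    rw [← h] at hy
    exact (mul_left_cancel₀ hx hy).symm
  · right
    filter_upwards [hxy] with y hy
    rw [show v x = -u x by linarith] at hy
    have := mul_left_cancel₀ hx (hy.trans (neg_mul_comm _ _))
    linarith
end
end

section
/- Let Ω ⊆ ℝ^N be an open set such that λ₁(Ω,s,q) > 0 for every q ∈ [2, 2*_s). Then the map q ↦ λ₁(Ω,s,q) is right-continuous at q = 2, i.e., lim_{q→2⁺} λ₁(Ω,s,q) = λ₁(Ω,s,2). -/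
open MeasureTheory Filter Topology
open scoped ENNReal RealInnerProductSpace

noncomputable section

/-- A `c`-Lipschitz change of the values multiplies the Gagliardo energy by at most `c²`. -/
theorem gagliardo_le_of_abs_sub_le {N : ℕ} {s c : ℝ} {u v : Euc N → ℝ}
    (h : ∀ x y, |v x - v y| ≤ c * |u x - u y|) :
    gagliardo N s v ≤ ENNReal.ofReal (c ^ 2) * gagliardo N s u := by
  unfold gagliardo
  rw [← lintegral_const_mul' _ _ ENNReal.ofReal_ne_top]
  refine lintegral_mono fun x => ?_
  rw [← lintegral_const_mul' _ _ ENNReal.ofReal_ne_top]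
  refine lintegral_mono fun y => ?_
  rw [← ENNReal.ofReal_mul (sq_nonneg c), ← mul_div_assoc]
  refine ENNReal.ofReal_le_ofReal ?_
  gcongr
  have h1 := pow_le_pow_left₀ (abs_nonneg _) (h x y) 2
  rwa [sq_abs, mul_pow, sq_abs] at h1

/-- The extended `p`-th power integral of `|u|` over `Ω`. -/
def lpow (N : ℕ) (Ω : Set (Euc N)) (p : ℝ) (u : Euc N → ℝ) : ℝ≥0∞ :=
  ∫⁻ x in Ω, ‖u x‖ₑ ^ p

theorem integral_abs_rpow_eq_one_iff {N : ℕ} {Ω : Set (Euc N)} {p : ℝ} (hp : 0 ≤ p)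
    {u : Euc N → ℝ} (hu : Measurable u) :
    (∫ x in Ω, |u x| ^ p) = 1 ↔ lpow N Ω p u = 1 := by
  have hmeas : Measurable fun x => |u x| ^ p := by fun_prop
  rw [integral_eq_lintegral_of_nonneg_ae
    (Eventually.of_forall fun x => Real.rpow_nonneg (abs_nonneg _) _)
    hmeas.aestronglyMeasurable, ENNReal.toReal_eq_one_iff, lpow]
  simp_rw [Real.enorm_eq_ofReal_abs, ENNReal.ofReal_rpow_of_nonneg (abs_nonneg _) hp]

theorem lpow_const_mul {N : ℕ} {Ω : Set (Euc N)} {p : ℝ} (hp : 0 ≤ p) (c : ℝ)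
    {u : Euc N → ℝ} (hu : Measurable u) :
    lpow N Ω p (fun x => c * u x) = ‖c‖ₑ ^ p * lpow N Ω p u := by
  unfold lpow
  rw [← lintegral_const_mul _ (by fun_prop)]
  simp_rw [enorm_mul, ENNReal.mul_rpow_of_nonneg _ _ hp]

theorem memK_of_abs_sub_le {N : ℕ} {s c : ℝ} {Ω : Set (Euc N)} {φ : ℝ → ℝ}
    (hφ : Measurable φ) (hφ0 : φ 0 = 0) (hc : ∀ a b, |φ a - φ b| ≤ c * |a - b|)
    {u : Euc N → ℝ} (hu : memK N s Ω u) : memK N s Ω (fun x => φ (u x)) := by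
  obtain ⟨hm, h0, hfin⟩ := hu
  refine ⟨hφ.comp hm, ?_, ?_⟩
  · filter_upwards [h0] with x hx hxΩ
    rw [hx hxΩ, hφ0]
  · exact (gagliardo_le_of_abs_sub_le fun x y => hc _ _).trans_lt
      (ENNReal.mul_lt_top ENNReal.ofReal_lt_top hfin)

/-- The Poincaré–Sobolev inequality encoded by `lambda1`. -/
theorem lambda1_mul_lpow_le {N : ℕ} {s p : ℝ} {Ω : Set (Euc N)} (hp : 0 < p)
    {u : Euc N → ℝ} (hu : memK N s Ω u) (h0 : lpow N Ω p u ≠ 0) (htop : lpow N Ω p u ≠ ⊤) :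
    lambda1 N s p Ω * lpow N Ω p u ^ (2 / p) ≤ gagliardo N s u := by
  set I := lpow N Ω p u with hI
  have hIpos : 0 < I.toReal := ENNReal.toReal_pos h0 htop
  set c : ℝ := I.toReal ^ (-1 / p) with hc
  have hcpos : 0 < c := Real.rpow_pos_of_pos hIpos _
  have hlip : ∀ a b : ℝ, |c * a - c * b| ≤ c * |a - b| := fun a b => by
    rw [← mul_sub, abs_mul, abs_of_pos hcpos]
  have hmem : memK N s Ω (fun x => c * u x) :=
    memK_of_abs_sub_le (measurable_const_mul c) (mul_zero c) hlip hu
  have hce : ENNReal.ofReal c = I ^ (-1 / p) := by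
    rw [hc, ← ENNReal.ofReal_rpow_of_pos hIpos, ENNReal.ofReal_toReal htop]
  have hone : (∫ x in Ω, |c * u x| ^ p) = 1 := by
    rw [integral_abs_rpow_eq_one_iff hp.le hmem.1, lpow_const_mul hp.le c hu.1, ← hI,
      Real.enorm_eq_ofReal hcpos.le, hce, ← ENNReal.rpow_mul, div_mul_cancel₀ _ hp.ne',
      ENNReal.rpow_neg_one, ENNReal.inv_mul_cancel h0 htop]
  have hle : lambda1 N s p Ω ≤ ENNReal.ofReal (c ^ 2) * gagliardo N s u :=
    (iInf₂_le (fun x => c * u x) ⟨hmem, hone⟩).trans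
      (gagliardo_le_of_abs_sub_le fun x y => hlip _ _)
  calc lambda1 N s p Ω * I ^ (2 / p)
      ≤ ENNReal.ofReal (c ^ 2) * gagliardo N s u * I ^ (2 / p) := by gcongr
    _ = (I ^ (-1 / p * 2) * I ^ (2 / p)) * gagliardo N s u := by
        rw [ENNReal.ofReal_pow hcpos.le, hce, ENNReal.rpow_mul, ENNReal.rpow_two]; ring
    _ = gagliardo N s u := by
        rw [← ENNReal.rpow_add _ _ h0 htop,
          show -1 / p * 2 + 2 / p = 0 by ring, ENNReal.rpow_zero, one_mul]

/-- Truncation of `|t|` which vanishes for `|t| ≤ 1 / (n + 1)` and is bounded by `n + 1`. -/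
def trunc (n : ℕ) (t : ℝ) : ℝ := min (max (|t| - 1 / (n + 1)) 0) (n + 1)

theorem measurable_trunc (n : ℕ) : Measurable (trunc n) := by
  unfold trunc; fun_prop

theorem trunc_nonneg (n : ℕ) (t : ℝ) : 0 ≤ trunc n t :=
  le_min (le_max_right _ _) (by positivity)

theorem trunc_le_abs (n : ℕ) (t : ℝ) : trunc n t ≤ |t| :=
  (min_le_left _ _).trans (max_le (sub_le_self _ (by positivity)) (abs_nonneg t))

theorem trunc_zero (n : ℕ) : trunc n 0 = 0 :=
  le_antisymm ((trunc_le_abs n 0).trans_eq abs_zero) (trunc_nonneg n 0)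

theorem abs_trunc_sub_le (n : ℕ) (a b : ℝ) : |trunc n a - trunc n b| ≤ 1 * |a - b| := by
  rw [one_mul]
  refine (abs_min_sub_min_le_max _ _ _ _).trans (max_le ?_ (by simp))
  refine (abs_max_sub_max_le_abs _ _ _).trans ?_
  rw [sub_sub_sub_cancel_right]
  exact abs_abs_sub_abs_le a b

theorem trunc_rpow_le (n : ℕ) {p P q : ℝ} (hp : 0 < p) (hpP : p ≤ P) (hq : 0 < q) (t : ℝ) :
    trunc n t ^ p ≤ ((n : ℝ) + 1) ^ (P + q) * |t| ^ q := by
  have hn : (0 : ℝ) < n + 1 := by positivity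
  have hn1 : (1 : ℝ) ≤ n + 1 := by linarith [n.cast_nonneg (α := ℝ)]
  rcases le_total (|t|) (1 / (n + 1)) with h | h
  · have : trunc n t = 0 :=
      le_antisymm ((min_le_left _ _).trans (max_le (by linarith) le_rfl)) (trunc_nonneg n t)
    rw [this, Real.zero_rpow hp.ne']
    positivity
  · have h1 : 1 ≤ (n + 1) * |t| := by rwa [div_le_iff₀' hn] at h
    calc trunc n t ^ p ≤ ((n : ℝ) + 1) ^ p :=
          Real.rpow_le_rpow (trunc_nonneg n t) (min_le_right _ _) hp.le
      _ ≤ ((n : ℝ) + 1) ^ P := Real.rpow_le_rpow_of_exponent_le hn1 hpP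
      _ ≤ ((n : ℝ) + 1) ^ P * (((n : ℝ) + 1) * |t|) ^ q :=
          le_mul_of_one_le_right (by positivity) (Real.one_le_rpow h1 hq.le)
      _ = _ := by rw [Real.mul_rpow hn.le (abs_nonneg t), Real.rpow_add hn, mul_assoc]

theorem enorm_trunc_rpow_le (n : ℕ) {p P q : ℝ} (hp : 0 < p) (hpP : p ≤ P) (hq : 0 < q)
    (t : ℝ) :
    ‖trunc n t‖ₑ ^ p ≤ ENNReal.ofReal (((n : ℝ) + 1) ^ (P + q)) * ‖t‖ₑ ^ q := by
  rw [Real.enorm_eq_ofReal (trunc_nonneg n t), Real.enorm_eq_ofReal_abs,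
    ENNReal.ofReal_rpow_of_nonneg (trunc_nonneg n t) hp.le,
    ENNReal.ofReal_rpow_of_nonneg (abs_nonneg t) hq.le, ← ENNReal.ofReal_mul (by positivity)]
  exact ENNReal.ofReal_le_ofReal (trunc_rpow_le n hp hpP hq t)

theorem tendsto_trunc (t : ℝ) : Tendsto (fun n => trunc n t) atTop (𝓝 |t|) := by
  have h1 : Tendsto (fun n : ℕ => max (|t| - 1 / ((n : ℝ) + 1)) 0) atTop (𝓝 |t|) := by
    have := ((tendsto_const_nhds (x := |t|)).sub
      (tendsto_one_div_add_atTop_nhds_zero_nat (𝕜 := ℝ))).max (tendsto_const_nhds (x := (0 : ℝ)))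
    simpa using this
  refine h1.congr' ?_
  filter_upwards [eventually_ge_atTop ⌈|t|⌉₊] with n hn
  have h2 : |t| ≤ n := Nat.ceil_le.mp hn
  refine (min_eq_left (max_le ?_ (by positivity))).symm
  have : (0 : ℝ) ≤ 1 / (n + 1) := by positivity
  linarith

theorem memK_trunc {N : ℕ} {s : ℝ} {Ω : Set (Euc N)} (n : ℕ) {u : Euc N → ℝ}
    (hu : memK N s Ω u) : memK N s Ω (fun x => trunc n (u x)) :=
  memK_of_abs_sub_le (measurable_trunc n) (trunc_zero n) (abs_trunc_sub_le n) hu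

theorem gagliardo_trunc_le {N : ℕ} {s : ℝ} (n : ℕ) (u : Euc N → ℝ) :
    gagliardo N s (fun x => trunc n (u x)) ≤ gagliardo N s u := by
  simpa using gagliardo_le_of_abs_sub_le (s := s) fun x y => abs_trunc_sub_le n (u x) (u y)

theorem lpow_trunc_ne_top {N : ℕ} {Ω : Set (Euc N)} (n : ℕ) {p q : ℝ} (hp : 0 < p) (hq : 0 < q)
    {u : Euc N → ℝ} (hu : lpow N Ω q u ≠ ⊤) : lpow N Ω p (fun x => trunc n (u x)) ≠ ⊤ := by
  refine ne_top_of_le_ne_top (ENNReal.mul_ne_top (ENNReal.ofReal_ne_top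
    (r := ((n : ℝ) + 1) ^ (p + q))) hu) ?_
  unfold lpow
  rw [← lintegral_const_mul' _ _ ENNReal.ofReal_ne_top]
  exact lintegral_mono fun x => enorm_trunc_rpow_le n hp le_rfl hq (u x)

theorem tendsto_lpow_trunc {N : ℕ} {Ω : Set (Euc N)} {q : ℝ} (hq : 0 < q)
    {u : Euc N → ℝ} (hm : Measurable u) (hu : lpow N Ω q u ≠ ⊤) :
    Tendsto (fun n => lpow N Ω q (fun x => trunc n (u x))) atTop (𝓝 (lpow N Ω q u)) := by
  refine tendsto_lintegral_of_dominated_convergence (fun x => ‖u x‖ₑ ^ q) (fun n => ?_)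
    (fun n => Eventually.of_forall fun x => ?_) hu (Eventually.of_forall fun x => ?_)
  · have := (measurable_trunc n).comp hm
    exact this.enorm.pow_const q
  · refine ENNReal.rpow_le_rpow ?_ hq.le
    rw [Real.enorm_eq_ofReal (trunc_nonneg n _), Real.enorm_eq_ofReal_abs]
    exact ENNReal.ofReal_le_ofReal (trunc_le_abs n _)
  · have h := (continuous_enorm.tendsto _).comp (tendsto_trunc (u x))
    rw [Real.enorm_abs] at h
    exact (ENNReal.continuous_rpow_const.tendsto _).comp h

theorem tendsto_lpow_exponent {N : ℕ} {Ω : Set (Euc N)} (n : ℕ) {u : Euc N → ℝ}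
    (hm : Measurable u) (hu : lpow N Ω 2 u ≠ ⊤) :
    Tendsto (fun q => lpow N Ω q (fun x => trunc n (u x))) (𝓝[>] 2)
      (𝓝 (lpow N Ω 2 (fun x => trunc n (u x)))) := by
  refine tendsto_lintegral_filter_of_dominated_convergence
    (fun x => ENNReal.ofReal (((n : ℝ) + 1) ^ ((3 : ℝ) + 2)) * ‖u x‖ₑ ^ (2 : ℝ))
    (Eventually.of_forall fun q => ?_) ?_ ?_ (Eventually.of_forall fun x => ?_)
  · have := (measurable_trunc n).comp hm
    exact this.enorm.pow_const q
  · filter_upwards [Ioo_mem_nhdsGT (show (2 : ℝ) < 3 by norm_num)] with q hq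
    exact Eventually.of_forall fun x =>
      enorm_trunc_rpow_le n (by linarith [hq.1]) hq.2.le two_pos (u x)
  · rw [lintegral_const_mul' _ _ ENNReal.ofReal_ne_top]
    exact ENNReal.mul_ne_top ENNReal.ofReal_ne_top hu
  · rw [Real.enorm_eq_ofReal (trunc_nonneg n _)]
    have h : Tendsto (fun q : ℝ => trunc n (u x) ^ q) (𝓝[>] 2) (𝓝 (trunc n (u x) ^ (2 : ℝ))) :=
      (Real.continuousAt_const_rpow' two_ne_zero).tendsto.mono_left nhdsWithin_le_nhds
    rw [ENNReal.ofReal_rpow_of_nonneg (trunc_nonneg n _) two_pos.le]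
    refine (ENNReal.tendsto_ofReal h).congr' ?_
    filter_upwards [self_mem_nhdsWithin] with q hq
    rw [ENNReal.ofReal_rpow_of_nonneg (trunc_nonneg n _) (two_pos.le.trans (le_of_lt hq))]

/-- Upper semicontinuity of `q ↦ lambda1 N s q Ω` at `2` from the right. -/
theorem eventually_lambda1_lt {N : ℕ} {s : ℝ} {Ω : Set (Euc N)} {b : ℝ≥0∞}
    (hb : lambda1 N s 2 Ω < b) : ∀ᶠ q in 𝓝[>] (2 : ℝ), lambda1 N s q Ω < b := by
  obtain ⟨u, ⟨hu, hone⟩, hub⟩ : ∃ u, (memK N s Ω u ∧ (∫ x in Ω, |u x| ^ (2 : ℝ)) = 1) ∧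
      gagliardo N s u < b := by
    simpa [lambda1, iInf_lt_iff] using hb
  rw [integral_abs_rpow_eq_one_iff two_pos.le hu.1] at hone
  have htop : lpow N Ω 2 u ≠ ⊤ := by simp [hone]
  have hE : gagliardo N s u ≠ ⊤ := hu.2.2.ne
  have hlim : Tendsto (fun I : ℝ≥0∞ => gagliardo N s u / I) (𝓝 1) (𝓝 (gagliardo N s u)) := by
    simpa using ENNReal.Tendsto.const_div (tendsto_id (x := 𝓝 (1 : ℝ≥0∞)))
      (Or.inr hE)
  have hn := tendsto_lpow_trunc two_pos hu.1 htop
  rw [hone] at hn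
  obtain ⟨n, hnb, hn0⟩ := (((hlim.comp hn).eventually_lt_const hub).and
    (hn.eventually_ne one_ne_zero)).exists
  have hfin := lpow_trunc_ne_top n two_pos two_pos htop
  have hq := tendsto_lpow_exponent n hu.1 htop
  have hq2 : Tendsto (fun q => lpow N Ω q (fun x => trunc n (u x)) ^ (2 / q)) (𝓝[>] 2)
      (𝓝 (lpow N Ω 2 (fun x => trunc n (u x)))) := by
    have hdiv : Tendsto (fun q : ℝ => 2 / q) (𝓝[>] 2) (𝓝 1) := by
      have : ContinuousAt (fun q : ℝ => 2 / q) 2 := by fun_prop (disch := norm_num)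
      simpa [ContinuousAt] using this.mono_left (nhdsWithin_le_nhds (s := Set.Ioi 2))
    have hcoe := ENNReal.tendsto_coe.mpr
      (((ENNReal.tendsto_toNNReal hfin).comp hq).nnrpow hdiv (Or.inr one_pos))
    rw [NNReal.rpow_one, ENNReal.coe_toNNReal hfin] at hcoe
    refine hcoe.congr' ?_
    filter_upwards [self_mem_nhdsWithin] with q hq'
    have hq0 : 0 < q := two_pos.trans hq'
    rw [ENNReal.coe_rpow_of_nonneg _ (by positivity), Function.comp_apply,
      ENNReal.coe_toNNReal (lpow_trunc_ne_top n hq0 two_pos htop)]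
  have hq3 := ENNReal.Tendsto.const_div hq2 (Or.inr hE)
  filter_upwards [hq3.eventually_lt_const hnb, hq.eventually_ne hn0, self_mem_nhdsWithin]
    with q h1 h2 h3
  have hq0 : 0 < q := two_pos.trans h3
  have hqt := lpow_trunc_ne_top n hq0 two_pos htop
  refine lt_of_le_of_lt ?_ h1
  rw [ENNReal.le_div_iff_mul_le (Or.inl (by simp [h2, hqt])) (Or.inr hE)]
  exact (lambda1_mul_lpow_le hq0 (memK_trunc n hu) h2 hqt).trans (gagliardo_trunc_le n u)

/-- Interpolation between the exponents `2` and `r`. -/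
theorem lpow_interpolation_le {N : ℕ} {Ω : Set (Euc N)} {r θ : ℝ} (hr : 0 ≤ r) (h0 : 0 ≤ θ)
    (h1 : θ ≤ 1) {v : Euc N → ℝ} (hv : Measurable v) :
    lpow N Ω (2 * (1 - θ) + r * θ) v ≤ lpow N Ω 2 v ^ (1 - θ) * lpow N Ω r v ^ θ := by
  have := ENNReal.lintegral_mul_norm_pow_le (μ := volume.restrict Ω)
    (hv.enorm.pow_const (2 : ℝ)).aemeasurable (hv.enorm.pow_const r).aemeasurable
    (sub_nonneg.mpr h1) h0 (by ring)
  refine le_trans (le_of_eq ?_) this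
  unfold lpow
  congr 1 with x
  rw [← ENNReal.rpow_mul, ← ENNReal.rpow_mul,
    ENNReal.rpow_add_of_nonneg _ _ (by nlinarith) (by positivity)]

theorem le_lambda1_of_interpolation {N : ℕ} {s : ℝ} {Ω : Set (Euc N)} {r θ : ℝ} {c d : ℝ≥0∞}
    (hr : 2 < r) (h0 : 0 ≤ θ) (h1 : θ ≤ 1) (hc0 : c ≠ 0) (hct : c ≠ ⊤) (hd0 : d ≠ 0)
    (hdt : d ≠ ⊤) (hc : c ≤ lambda1 N s 2 Ω) (hd : d ≤ lambda1 N s r Ω) :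
    (c ^ (1 - θ) * d ^ (r / 2 * θ)) ^ (2 / (2 * (1 - θ) + r * θ)) ≤
      lambda1 N s (2 * (1 - θ) + r * θ) Ω := by
  set q := 2 * (1 - θ) + r * θ with hq
  have hr0 : 0 < r := by linarith
  have hq0 : 0 < q := by nlinarith
  refine le_iInf₂ fun u ⟨hu, hone⟩ => ?_
  rw [integral_abs_rpow_eq_one_iff hq0.le hu.1] at hone
  have htop : lpow N Ω q u ≠ ⊤ := by simp [hone]
  set E := gagliardo N s u with hE
  have hP : ∀ p : ℝ, 0 < p → ∀ a : ℝ≥0∞, a ≠ 0 → a ≠ ⊤ → a ≤ lambda1 N s p Ω → ∀ n,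
      lpow N Ω p (fun x => trunc n (u x)) ≤ (E / a) ^ (p / 2) := by
    intro p hp a ha0 hat ha n
    rcases eq_or_ne (lpow N Ω p (fun x => trunc n (u x))) 0 with h | h
    · rw [h]; exact zero_le
    · have h2 := (lambda1_mul_lpow_le hp (memK_trunc n hu) h
        (lpow_trunc_ne_top n hp hq0 htop)).trans (gagliardo_trunc_le n u)
      have h3 : lpow N Ω p (fun x => trunc n (u x)) ^ (2 / p) ≤ E / a := by
        rw [ENNReal.le_div_iff_mul_le (Or.inl ha0) (Or.inl hat), mul_comm]
        exact (mul_le_mul_left ha _).trans h2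
      have h4 := ENNReal.rpow_le_rpow h3 (show 0 ≤ p / 2 by positivity)
      rwa [← ENNReal.rpow_mul, show 2 / p * (p / 2) = 1 by field_simp, ENNReal.rpow_one] at h4
  have hbound : lpow N Ω q u ≤ (E / c) ^ (1 - θ) * ((E / d) ^ (r / 2)) ^ θ := by
    refine le_of_tendsto (tendsto_lpow_trunc hq0 hu.1 htop) (Eventually.of_forall fun n => ?_)
    refine (lpow_interpolation_le hr0.le h0 h1 (memK_trunc n hu).1).trans ?_
    have hc2 := hP 2 two_pos c hc0 hct hc n
    rw [div_self two_ne_zero, ENNReal.rpow_one] at hc2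
    exact mul_le_mul' (ENNReal.rpow_le_rpow hc2 (sub_nonneg.mpr h1))
      (ENNReal.rpow_le_rpow (hP r hr0 d hd0 hdt hd n) h0)
  have hθ : 0 ≤ 1 - θ := sub_nonneg.mpr h1
  have hθ' : 0 ≤ r / 2 * θ := by positivity
  have hkey : c ^ (1 - θ) * d ^ (r / 2 * θ) ≤ E ^ (q / 2) := by
    calc c ^ (1 - θ) * d ^ (r / 2 * θ)
        ≤ c ^ (1 - θ) * d ^ (r / 2 * θ) * ((E / c) ^ (1 - θ) * ((E / d) ^ (r / 2)) ^ θ) :=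
          le_mul_of_one_le_right' (hone.symm.trans_le hbound)
      _ = (c * (E / c)) ^ (1 - θ) * (d * (E / d)) ^ (r / 2 * θ) := by
          rw [← ENNReal.rpow_mul, ENNReal.mul_rpow_of_nonneg _ _ hθ,
            ENNReal.mul_rpow_of_nonneg _ _ hθ']
          ring
      _ = E ^ (q / 2) := by
          rw [ENNReal.mul_div_cancel hc0 hct, ENNReal.mul_div_cancel hd0 hdt,
            ← ENNReal.rpow_add_of_nonneg _ _ hθ hθ', hq]
          ring_nf
  have := ENNReal.rpow_le_rpow hkey (show 0 ≤ 2 / q by positivity)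
  rwa [← ENNReal.rpow_mul, show q / 2 * (2 / q) = 1 by field_simp, ENNReal.rpow_one] at this

theorem exists_subcritical_exponent {N s : ℝ} (hs : 0 < s) :
    ∃ r : ℝ, 2 < r ∧ (2 * s < N → r < 2 * N / (N - 2 * s)) := by
  by_cases h : 2 * s < N
  · have h2 : 2 < 2 * N / (N - 2 * s) := by
      rw [lt_div_iff₀ (by linarith)]; linarith
    obtain ⟨r, hr, hr'⟩ := exists_between h2
    exact ⟨r, hr, fun _ => hr'⟩
  · exact ⟨3, by norm_num, fun h' => absurd h' h⟩

/-- Lower semicontinuity of `q ↦ lambda1 N s q Ω` at `2` from the right. -/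
theorem eventually_lt_lambda1 {N : ℕ} {s r : ℝ} {Ω : Set (Euc N)} (hr : 2 < r)
    (hpos : 0 < lambda1 N s r Ω) {a : ℝ≥0∞} (ha : a < lambda1 N s 2 Ω) :
    ∀ᶠ q in 𝓝[>] (2 : ℝ), a < lambda1 N s q Ω := by
  obtain ⟨c, hac, hc⟩ := exists_between ha
  obtain ⟨d, hd0, hd⟩ := exists_between hpos
  have hct : c ≠ ⊤ := hc.ne_top
  have hc0 : c ≠ 0 := hac.ne_bot
  have hdt : d ≠ ⊤ := hd.ne_top
  lift c to NNReal using hct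
  lift d to NNReal using hdt
  have hc0' : c ≠ 0 := by simpa using hc0
  have hd0' : d ≠ 0 := by simpa using hd0.ne'
  have hr2 : r - 2 ≠ 0 := by linarith
  have hθ : Tendsto (fun q : ℝ => (q - 2) / (r - 2)) (𝓝 2) (𝓝 0) := by
    have : ContinuousAt (fun q : ℝ => (q - 2) / (r - 2)) 2 := by fun_prop
    simpa [ContinuousAt] using this
  have hlim : Tendsto (fun q : ℝ => (c ^ (1 - (q - 2) / (r - 2)) *
      d ^ (r / 2 * ((q - 2) / (r - 2)))) ^ (2 / q)) (𝓝 2) (𝓝 c) := by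
    have h1 := (tendsto_const_nhds (x := c)).nnrpow ((tendsto_const_nhds (x := (1 : ℝ))).sub hθ)
      (Or.inl hc0')
    have h2 := (tendsto_const_nhds (x := d)).nnrpow (hθ.const_mul (r / 2)) (Or.inl hd0')
    have h3 : Tendsto (fun q : ℝ => 2 / q) (𝓝 2) (𝓝 1) := by
      have : ContinuousAt (fun q : ℝ => 2 / q) 2 := by fun_prop (disch := norm_num)
      simpa [ContinuousAt] using this
    simpa using (h1.mul h2).nnrpow h3 (Or.inr one_pos)
  have hlim' := (ENNReal.tendsto_coe.mpr hlim).mono_left (nhdsWithin_le_nhds (s := Set.Ioi 2))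
  filter_upwards [hlim'.eventually_const_lt hac, Ioo_mem_nhdsGT hr] with q h1 hq
  have hq2 := hq.1
  have hqr := hq.2
  refine h1.trans_le ?_
  have h := le_lambda1_of_interpolation (θ := (q - 2) / (r - 2)) hr
    (div_nonneg (by linarith) (by linarith)) ((div_le_one (by linarith)).mpr (by linarith))
    hc0 ENNReal.coe_ne_top hd0.ne' ENNReal.coe_ne_top hc.le hd.le
  rw [show 2 * (1 - (q - 2) / (r - 2)) + r * ((q - 2) / (r - 2)) = q by field_simp; ring] at h
  refine le_trans (le_of_eq ?_) h
  rw [ENNReal.coe_rpow_of_nonneg _ (by positivity), ENNReal.coe_mul,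
    ENNReal.coe_rpow_of_ne_zero hc0', ENNReal.coe_rpow_of_ne_zero hd0']

/-- right-continuity of `q ↦ λ₁(Ω,s,q)` at `q = 2`. -/
theorem stmt_5 (N : ℕ) (hN : 1 ≤ N) (s : ℝ) (hs : s ∈ Set.Ioo (0 : ℝ) 1)
    (Ω : Set (Euc N)) (hΩ : IsOpen Ω)
    (hpos : ∀ q : ℝ, 2 ≤ q → (2 * s < (N : ℝ) → q < 2 * N / ((N : ℝ) - 2 * s)) →
      0 < lambda1 N s q Ω) :
    Tendsto (fun q : ℝ => lambda1 N s q Ω) (𝓝[>] (2 : ℝ)) (𝓝 (lambda1 N s 2 Ω)) := by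
  obtain ⟨r, hr, hr'⟩ := exists_subcritical_exponent (N := (N : ℝ)) hs.1
  exact tendsto_order.mpr ⟨fun a ha => eventually_lt_lambda1 hr (hpos r hr.le hr') ha,
    fun b hb => eventually_lambda1_lt hb⟩
end
end

section
/- Let s ∈ (0,1) and let Ω ⊂ ℝ^N be a bounded open set satisfying a uniform exterior cone condition: there exist ℓ > 0 and α ∈ (0, π/2) such that for every ξ ∈ ∂Ω there is a unit vector v_ξ ∈ ℝ^N with { y ∈ ℝ^N : |y − ξ| ≤ ℓ and ⟨y − ξ, v_ξ⟩ ≥ cos(α)·|y − ξ| } ⊆ ℝ^N ∖ Ω. Then there exists a constant C > 0, depending only on Ω, N, s, ℓ and α, such that for every u ∈ C^∞_c(Ω): ∫_Ω u(x)²/dist(x, ∂Ω)^{2s} dx ≤ C ∫_{ℝ^N}∫_{ℝ^N} (u(x)−u(y))²/|x−y|^{N+2s} dx dy. -/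
open MeasureTheory Filter Topology
open scoped ENNReal RealInnerProductSpace

noncomputable section

/-- A cone of opening `arccos c` with vertex `ξ` and axis `v` contains a ball of radius comparable
to its height. -/
lemma mem_cone_of_mem_ball {N : ℕ} {c r : ℝ} (hc0 : 0 ≤ c) (hc1 : c < 1) (hr : 0 < r)
    {ξ v y : Euc N} (hv : ‖v‖ = 1)
    (hy : y ∈ Metric.ball (ξ + (r / 2) • v) ((1 - c) / 4 * r)) :
    ‖y - ξ‖ ≤ r ∧ c * ‖y - ξ‖ ≤ ⟪y - ξ, v⟫ := by
  obtain ⟨w, rfl⟩ : ∃ w, y = ξ + (r / 2) • v + w := ⟨y - (ξ + (r / 2) • v), by abel⟩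
  have hw : ‖w‖ < (1 - c) / 4 * r := by simpa [dist_eq_norm] using hy
  have hsub : ξ + (r / 2) • v + w - ξ = (r / 2) • v + w := by abel
  have hnorm : ‖(r / 2) • v + w‖ ≤ r / 2 + ‖w‖ := by
    refine (norm_add_le _ _).trans_eq ?_
    rw [norm_smul, hv, mul_one, Real.norm_of_nonneg (by positivity)]
  have hinner : r / 2 - ‖w‖ ≤ ⟪(r / 2) • v + w, v⟫ := by
    have h1 : |⟪w, v⟫| ≤ ‖w‖ := by simpa [hv] using abs_real_inner_le_norm w v
    rw [inner_add_left, real_inner_smul_left, real_inner_self_eq_norm_sq, hv]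
    linarith [(abs_le.mp h1).1]
  rw [hsub]
  refine ⟨by nlinarith, ?_⟩
  have := mul_le_mul_of_nonneg_left hnorm hc0
  nlinarith [mul_pos (sub_pos.mpr hc1) hr, mul_nonneg (sub_nonneg.mpr hc1.le) hr.le,
    mul_nonneg (mul_nonneg (sub_nonneg.mpr hc1.le) (sub_nonneg.mpr hc1.le)) hr.le,
    mul_le_mul_of_nonneg_left hw.le hc0]

/-- If `u` vanishes on a ball of radius `κ d` contained in the ball of radius `2 d` around `x`, then
the Gagliardo integrand at `x` controls `u x ^ 2 / d ^ (2 s)`. -/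
lemma le_lintegral_of_eq_zero_on_ball {N : ℕ} {s : ℝ} (hs : 0 ≤ s) {κ d : ℝ} (hκ : 0 < κ)
    (hd : 0 < d) {u : Euc N → ℝ} {x z : Euc N}
    (hu : ∀ y ∈ Metric.ball z (κ * d), u y = 0)
    (hx : ∀ y ∈ Metric.ball z (κ * d), x ≠ y ∧ ‖x - y‖ ≤ 2 * d) :
    ENNReal.ofReal (u x ^ 2 / d ^ (2 * s)) ≤
      ENNReal.ofReal ((2 : ℝ) ^ ((N : ℝ) + 2 * s) /
        (κ ^ N * (volume (Metric.ball (0 : Euc N) 1)).toReal)) *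
        ∫⁻ y : Euc N, ENNReal.ofReal ((u x - u y) ^ 2 / ‖x - y‖ ^ ((N : ℝ) + 2 * s)) := by
  have hKpos : 0 < (volume (Metric.ball (0 : Euc N) 1)).toReal :=
    ENNReal.toReal_pos (Metric.measure_ball_pos volume _ one_pos).ne' measure_ball_lt_top.ne
  have hball : volume (Metric.ball z (κ * d)) =
      ENNReal.ofReal ((κ * d) ^ N * (volume (Metric.ball (0 : Euc N) 1)).toReal) := by
    rw [Measure.addHaar_ball_of_pos volume z (by positivity), finrank_euclideanSpace_fin,
      ENNReal.ofReal_mul (by positivity), ENNReal.ofReal_toReal measure_ball_lt_top.ne]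
  have hint : ENNReal.ofReal (u x ^ 2 / (2 * d) ^ ((N : ℝ) + 2 * s)) *
      volume (Metric.ball z (κ * d)) ≤
      ∫⁻ y : Euc N, ENNReal.ofReal ((u x - u y) ^ 2 / ‖x - y‖ ^ ((N : ℝ) + 2 * s)) := by
    rw [← setLIntegral_const]
    refine (setLIntegral_mono' measurableSet_ball fun y hy => ?_).trans
      (setLIntegral_le_lintegral (Metric.ball z (κ * d)) _)
    obtain ⟨hne, hle⟩ := hx y hy
    have hpos : 0 < ‖x - y‖ := norm_pos_iff.mpr (sub_ne_zero.mpr hne)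
    rw [hu y hy, sub_zero]
    gcongr
  refine le_trans (le_of_eq ?_) (mul_le_mul_right hint _)
  rw [hball, ← ENNReal.ofReal_mul (by positivity), ← ENNReal.ofReal_mul (by positivity),
    Real.mul_rpow (by norm_num) hd.le, Real.rpow_add hd, Real.rpow_natCast, mul_pow]
  congr 1
  have : 0 < (2 : ℝ) ^ ((N : ℝ) + 2 * s) := by positivity
  have : 0 < d ^ (2 * s) := by positivity
  field_simp

/-- fractional Hardy inequality under a uniform exterior cone condition. -/
theorem stmt_11 (N : ℕ) (hN : 1 ≤ N) (s : ℝ) (hs : s ∈ Set.Ioo (0 : ℝ) 1)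
    (Ω : Set (Euc N)) (hΩo : IsOpen Ω) (hΩb : Bornology.IsBounded Ω)
    (ℓ α : ℝ) (hℓ : 0 < ℓ) (hα : α ∈ Set.Ioo (0 : ℝ) (Real.pi / 2))
    (hcone : ∀ ξ ∈ frontier Ω, ∃ v : Euc N, ‖v‖ = 1 ∧
      {y : Euc N | ‖y - ξ‖ ≤ ℓ ∧ Real.cos α * ‖y - ξ‖ ≤ ⟪y - ξ, v⟫} ⊆ Ωᶜ) :
    ∃ C : ℝ, 0 < C ∧
      ∀ u : Euc N → ℝ, ContDiff ℝ (⊤ : ℕ∞) u → HasCompactSupport u → tsupport u ⊆ Ω →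
        (∫⁻ x in Ω, ENNReal.ofReal (u x ^ 2 / Metric.infDist x (frontier Ω) ^ (2 * s))) ≤
          ENNReal.ofReal C * gagliardo N s u := by
  have : Nontrivial (Euc N) :=
    Module.nontrivial_of_finrank_pos (R := ℝ) (by rw [finrank_euclideanSpace_fin]; exact hN)
  obtain ⟨hα0, hα1⟩ := hα
  have hc0 : 0 ≤ Real.cos α := Real.cos_nonneg_of_mem_Icc ⟨by linarith, hα1.le⟩
  have hc1 : Real.cos α < 1 := by
    simpa using Real.cos_lt_cos_of_nonneg_of_le_pi le_rfl (by linarith [Real.pi_pos]) hα0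
  obtain ⟨R, hR, hΩR⟩ := hΩb.closure.subset_ball_lt 0 (0 : Euc N)
  set t : ℝ := min 1 (ℓ / (2 * R))
  have ht : 0 < t := by positivity
  have hκ : 0 < (1 - Real.cos α) / 4 * t := by
    have := sub_pos.mpr hc1
    positivity
  have hKpos : 0 < (volume (Metric.ball (0 : Euc N) 1)).toReal :=
    ENNReal.toReal_pos (Metric.measure_ball_pos volume _ one_pos).ne' measure_ball_lt_top.ne
  refine ⟨(2 : ℝ) ^ ((N : ℝ) + 2 * s) / (((1 - Real.cos α) / 4 * t) ^ N *
    (volume (Metric.ball (0 : Euc N) 1)).toReal), by positivity, fun u _ _ hu => ?_⟩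
  rw [gagliardo, ← lintegral_const_mul' _ _ ENNReal.ofReal_ne_top]
  refine (setLIntegral_mono' hΩo.measurableSet fun x hx => ?_).trans (setLIntegral_le_lintegral Ω _)
  have hne : (frontier Ω).Nonempty := nonempty_frontier_iff.mpr ⟨⟨x, hx⟩, fun h =>
    NormedSpace.unbounded_univ ℝ (Euc N) (h ▸ hΩb)⟩
  obtain ⟨ξ, hξ, hd⟩ := isClosed_frontier.exists_infDist_eq_dist hne x
  obtain ⟨v, hv, hcone⟩ := hcone ξ hξ
  rw [hd]
  have hdpos : 0 < dist x ξ := dist_pos.mpr fun h =>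
    (hΩo.frontier_eq ▸ hξ : ξ ∈ closure Ω \ Ω).2 (h ▸ hx)
  have hdR : dist x ξ ≤ 2 * R := by
    have h1 := Metric.mem_ball.mp (hΩR (subset_closure hx))
    have h2 := Metric.mem_ball'.mp (hΩR (frontier_subset_closure hξ))
    linarith [dist_triangle x 0 ξ]
  have hrd : t * dist x ξ ≤ dist x ξ := mul_le_of_le_one_left hdpos.le (min_le_left _ _)
  have hrℓ : t * dist x ξ ≤ ℓ := calc
    t * dist x ξ ≤ ℓ / (2 * R) * (2 * R) := by
      gcongr
      exact min_le_right _ _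
    _ = ℓ := by field_simp
  have hmem : ∀ y ∈ Metric.ball (ξ + (t * dist x ξ / 2) • v)
      ((1 - Real.cos α) / 4 * t * dist x ξ), ‖y - ξ‖ ≤ t * dist x ξ ∧ y ∉ Ω := by
    intro y hy
    rw [mul_assoc] at hy
    obtain ⟨h1, h2⟩ := mem_cone_of_mem_ball hc0 hc1 (by positivity) hv hy
    exact ⟨h1, hcone ⟨h1.trans hrℓ, h2⟩⟩
  refine le_lintegral_of_eq_zero_on_ball (z := ξ + (t * dist x ξ / 2) • v) hs.1.le hκ hdpos
    (fun y hy => ?_) (fun y hy => ⟨fun h => (hmem y hy).2 (h ▸ hx), ?_⟩)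
  · exact image_eq_zero_of_notMem_tsupport fun h => (hmem y hy).2 (hu h)
  · have h1 := dist_triangle x ξ y
    rw [dist_comm ξ y, dist_eq_norm y ξ, dist_eq_norm x y] at h1
    linarith [(hmem y hy).1]
end
end

section
/- Let q ∈ (1,2). There exists a constant C > 0, depending only on N, s and q, such that for every open set Ω ⊆ ℝ^N with λ₁(Ω,s,2) > 0 and every Lane–Emden density w of Ω (a minimizer of J_Ω among nonnegative functions in 𝒦(Ω)), one has w ∈ L^∞(Ω) and ‖w‖_{L^∞(Ω)}^{2−q} · λ₁(Ω,s,2) ≤ C. -/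
open MeasureTheory Filter Topology
open scoped ENNReal RealInnerProductSpace

noncomputable section

/-- The truncated kernel controlling the energy of a Lipschitz cutoff at scale `ρ`. -/
def cutoffKernel (N : ℕ) (s ρ : ℝ) (h : Euc N) : ℝ≥0∞ :=
  ENNReal.ofReal (4 * min 1 ((‖h‖ / ρ) ^ 2) / ‖h‖ ^ ((N : ℝ) + 2 * s))

lemma measurable_cutoffKernel (N : ℕ) (s ρ : ℝ) : Measurable (cutoffKernel N s ρ) := by
  unfold cutoffKernel
  fun_prop

lemma integrableOn_radial_cutoffKernel {N : ℕ} (hN : 1 ≤ N) {s : ℝ} (hs : s ∈ Set.Ioo (0 : ℝ) 1) :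
    IntegrableOn (fun r : ℝ => r ^ (N - 1) • (4 * min 1 (r ^ 2) / r ^ ((N : ℝ) + 2 * s)))
      (Set.Ioi 0) := by
  have hcast : ((N - 1 : ℕ) : ℝ) = N - 1 := by push_cast [Nat.cast_sub hN]; ring
  rw [← Set.Ioc_union_Ioi_eq_Ioi zero_le_one]
  refine IntegrableOn.union ?_ ?_
  · rw [integrableOn_Ioc_iff_integrableOn_Ioo]
    have h1 : IntegrableOn (fun r : ℝ => 4 * r ^ (1 - 2 * s)) (Set.Ioo 0 1) :=
      ((intervalIntegral.integrableOn_Ioo_rpow_iff zero_lt_one).2 (by linarith [hs.2])).const_mul 4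
    refine h1.congr_fun (fun r hr => ?_) measurableSet_Ioo
    have hr0 : 0 < r := hr.1
    have hmin : min 1 (r ^ 2) = r ^ 2 := min_eq_right (by nlinarith [hr.1, hr.2])
    simp only [smul_eq_mul, hmin]
    rw [← Real.rpow_natCast r (N - 1), ← Real.rpow_natCast r 2, hcast]
    rw [mul_div_assoc, ← Real.rpow_sub hr0, mul_left_comm, ← Real.rpow_add hr0]
    congr 2
    push_cast
    ring
  · have h1 : IntegrableOn (fun r : ℝ => 4 * r ^ (-1 - 2 * s)) (Set.Ioi 1) :=
      (integrableOn_Ioi_rpow_of_lt (by linarith [hs.1]) zero_lt_one).const_mul 4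
    refine h1.congr_fun (fun r hr => ?_) measurableSet_Ioi
    have hr1 : 1 < r := hr
    have hr0 : 0 < r := by linarith
    have hmin : min 1 (r ^ 2) = 1 := min_eq_left (by nlinarith)
    simp only [smul_eq_mul, hmin]
    rw [← Real.rpow_natCast r (N - 1), hcast, mul_one, div_eq_mul_inv, ← Real.rpow_neg hr0.le,
      mul_left_comm, ← Real.rpow_add hr0]
    congr 2
    ring

lemma lintegral_cutoffKernel_one_lt_top {N : ℕ} (hN : 1 ≤ N) {s : ℝ}
    (hs : s ∈ Set.Ioo (0 : ℝ) 1) : ∫⁻ h, cutoffKernel N s 1 h < ⊤ := by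
  have : Nonempty (Fin N) := ⟨⟨0, hN⟩⟩
  have : Nontrivial (Euc N) := by
    apply Module.nontrivial_of_finrank_pos (R := ℝ); simp; omega
  have h := (integrable_fun_norm_addHaar (E := Euc N) volume
    (f := fun r : ℝ => 4 * min 1 (r ^ 2) / r ^ ((N : ℝ) + 2 * s))).2
    (by simpa using integrableOn_radial_cutoffKernel hN hs)
  simpa [cutoffKernel] using h.lintegral_lt_top

lemma lintegral_cutoffKernel {N : ℕ} {s ρ : ℝ} (hρ : 0 < ρ) :
    ∫⁻ h, cutoffKernel N s ρ h
      = ENNReal.ofReal (ρ ^ (-(2 * s))) * ∫⁻ h, cutoffKernel N s 1 h := by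
  have hpt : ∀ h : Euc N, cutoffKernel N s ρ h
      = ENNReal.ofReal (ρ ^ (-((N : ℝ) + 2 * s))) * cutoffKernel N s 1 (ρ⁻¹ • h) := by
    intro h
    unfold cutoffKernel
    rw [← ENNReal.ofReal_mul (by positivity)]
    congr 1
    rw [norm_smul, norm_inv, Real.norm_of_nonneg hρ.le, div_one,
      Real.mul_rpow (by positivity) (by positivity), Real.inv_rpow hρ.le, Real.rpow_neg hρ.le,
      inv_mul_eq_div]
    have : ρ ^ ((N : ℝ) + 2 * s) ≠ 0 := by positivity
    field_simp
  simp_rw [hpt]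
  rw [lintegral_const_mul' _ _ ENNReal.ofReal_ne_top]
  have hm : ∫⁻ h, cutoffKernel N s 1 (ρ⁻¹ • h)
      = ∫⁻ h, cutoffKernel N s 1 h ∂(Measure.map (ρ⁻¹ • ·) (volume : Measure (Euc N))) :=
    (lintegral_map (measurable_cutoffKernel N s 1) (measurable_const_smul _)).symm
  rw [hm, Measure.map_addHaar_smul _ (inv_ne_zero hρ.ne'), lintegral_smul_measure, smul_eq_mul,
    ← mul_assoc, ← ENNReal.ofReal_mul (by positivity)]
  congr 2
  simp only [finrank_euclideanSpace, Fintype.card_fin]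
  rw [abs_of_nonneg (by positivity), inv_pow, inv_inv, ← Real.rpow_natCast, ← Real.rpow_add hρ]
  congr 1
  ring

lemma volume_euc_ball (N : ℕ) (x : Euc N) {ρ : ℝ} (hρ : 0 < ρ) :
    volume (Metric.ball x ρ)
      = ENNReal.ofReal (ρ ^ (N : ℝ) * (volume (Metric.ball (0 : Euc N) 1)).toReal) := by
  rw [Measure.addHaar_ball_of_pos _ _ hρ, ENNReal.ofReal_mul (by positivity),
    ENNReal.ofReal_toReal measure_ball_lt_top.ne]
  simp

/-- Angle of the trigonometric partition of unity `cos ² + sin ² = 1` adapted to `ball x₀ ρ`. -/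
def cutoffAngle (N : ℕ) (x₀ : Euc N) (ρ : ℝ) (x : Euc N) : ℝ :=
  Real.pi / 2 * min 1 (‖x - x₀‖ / ρ)

lemma measurable_cutoffAngle (N : ℕ) (x₀ : Euc N) (ρ : ℝ) :
    Measurable (cutoffAngle N x₀ ρ) := by
  unfold cutoffAngle
  fun_prop

lemma cutoffAngle_mem (N : ℕ) (x₀ : Euc N) {ρ : ℝ} (hρ : 0 < ρ) (x : Euc N) :
    cutoffAngle N x₀ ρ x ∈ Set.Icc 0 (Real.pi / 2) := by
  have hpi := Real.pi_pos
  unfold cutoffAngle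
  constructor
  · positivity
  · nlinarith [min_le_left 1 (‖x - x₀‖ / ρ)]

lemma cutoffAngle_of_notMem (N : ℕ) (x₀ : Euc N) {ρ : ℝ} (hρ : 0 < ρ) {x : Euc N}
    (hx : x ∉ Metric.ball x₀ ρ) : cutoffAngle N x₀ ρ x = Real.pi / 2 := by
  have h : 1 ≤ ‖x - x₀‖ / ρ := by
    rw [one_le_div hρ, ← dist_eq_norm]
    simpa using hx
  rw [cutoffAngle, min_eq_left h, mul_one]

lemma half_le_cos_cutoffAngle_sq (N : ℕ) (x₀ : Euc N) {ρ : ℝ} (hρ : 0 < ρ) {x : Euc N}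
    (hx : x ∈ Metric.ball x₀ (ρ / 2)) : 1 / 2 ≤ Real.cos (cutoffAngle N x₀ ρ x) ^ 2 := by
  have hpi := Real.pi_pos
  have h : ‖x - x₀‖ / ρ ≤ 1 / 2 := by
    rw [div_le_iff₀ hρ, ← dist_eq_norm]
    have := Metric.mem_ball.1 hx
    linarith
  have hle : cutoffAngle N x₀ ρ x ≤ Real.pi / 4 := by
    unfold cutoffAngle
    nlinarith [min_le_right 1 (‖x - x₀‖ / ρ)]
  rw [Real.cos_sq]
  have : 0 ≤ Real.cos (2 * cutoffAngle N x₀ ρ x) :=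
    Real.cos_nonneg_of_mem_Icc ⟨by linarith [(cutoffAngle_mem N x₀ hρ x).1], by linarith⟩
  linarith

lemma abs_cutoffAngle_sub_le (N : ℕ) (x₀ : Euc N) {ρ : ℝ} (hρ : 0 < ρ) (x y : Euc N) :
    |cutoffAngle N x₀ ρ x - cutoffAngle N x₀ ρ y| ≤ Real.pi / 2 * (‖x - y‖ / ρ) := by
  have hpi := Real.pi_pos
  unfold cutoffAngle
  rw [← mul_sub, abs_mul, abs_of_pos (by positivity : 0 < Real.pi / 2)]
  gcongr
  refine (abs_min_sub_min_le_max _ _ _ _).trans ?_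
  rw [sub_self, abs_zero, ← sub_div, abs_div, abs_of_pos hρ]
  refine max_le (by positivity) ?_
  gcongr
  simpa using abs_norm_sub_norm_le (x - x₀) (y - x₀)

lemma cutoffAngle_defect_le (N : ℕ) (x₀ : Euc N) {ρ : ℝ} (hρ : 0 < ρ) (x y : Euc N) :
    2 * (1 - Real.cos (cutoffAngle N x₀ ρ x - cutoffAngle N x₀ ρ y))
      ≤ 4 * min 1 ((‖x - y‖ / ρ) ^ 2) := by
  set t := cutoffAngle N x₀ ρ x - cutoffAngle N x₀ ρ y with ht
  have h1 := Real.neg_one_le_cos t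
  have h2 := Real.one_sub_sq_div_two_le_cos (x := t)
  have h3 : t ^ 2 ≤ 4 * (‖x - y‖ / ρ) ^ 2 := by
    have h4 : |t| ≤ 2 * (‖x - y‖ / ρ) := by
      refine (abs_cutoffAngle_sub_le N x₀ hρ x y).trans ?_
      have := Real.pi_le_four
      gcongr
      linarith
    calc t ^ 2 = |t| ^ 2 := (sq_abs t).symm
      _ ≤ (2 * (‖x - y‖ / ρ)) ^ 2 := by gcongr
      _ = _ := by ring
  rcases min_cases (1 : ℝ) ((‖x - y‖ / ρ) ^ 2) with h | h <;> rw [h.1] <;> linarith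

/-- Total energy of the cutoff at scale `ρ`. -/
lemma lintegral_cutoff_defect_le {N : ℕ} {s : ℝ} (x₀ : Euc N) {ρ : ℝ} (hρ : 0 < ρ) :
    ∫⁻ x : Euc N, ∫⁻ y : Euc N, ENNReal.ofReal
        (2 * (1 - Real.cos (cutoffAngle N x₀ ρ x - cutoffAngle N x₀ ρ y))
          / ‖x - y‖ ^ ((N : ℝ) + 2 * s))
      ≤ 2 * volume (Metric.ball x₀ ρ) * ∫⁻ h, cutoffKernel N s ρ h := by
  set B := Metric.ball x₀ ρ
  set κ := cutoffKernel N s ρ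
  have hκ : Measurable κ := measurable_cutoffKernel N s ρ
  have hB : MeasurableSet B := measurableSet_ball
  let ind : Euc N → ℝ≥0∞ := B.indicator 1
  have hind : Measurable ind := measurable_one.indicator hB
  have hpt : ∀ x y : Euc N, ENNReal.ofReal
        (2 * (1 - Real.cos (cutoffAngle N x₀ ρ x - cutoffAngle N x₀ ρ y))
          / ‖x - y‖ ^ ((N : ℝ) + 2 * s)) ≤ ind x * κ (x - y) + ind y * κ (x - y) := by
    intro x y
    have hle : ENNReal.ofReal
        (2 * (1 - Real.cos (cutoffAngle N x₀ ρ x - cutoffAngle N x₀ ρ y))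
          / ‖x - y‖ ^ ((N : ℝ) + 2 * s)) ≤ κ (x - y) := by
      apply ENNReal.ofReal_le_ofReal
      exact div_le_div_of_nonneg_right (cutoffAngle_defect_le N x₀ hρ x y) (by positivity)
    by_cases hx : x ∈ B
    · simp only [ind, Set.indicator_of_mem hx, Pi.one_apply, one_mul]
      exact hle.trans le_self_add
    by_cases hy : y ∈ B
    · simp only [ind, Set.indicator_of_mem hy, Pi.one_apply, one_mul]
      exact hle.trans le_add_self
    · rw [cutoffAngle_of_notMem N x₀ hρ hx, cutoffAngle_of_notMem N x₀ hρ hy]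
      simp
  have hfirst : ∫⁻ x : Euc N, ∫⁻ y : Euc N, ind x * κ (x - y)
      = volume B * ∫⁻ h, κ h := by
    have : ∀ x : Euc N, ∫⁻ y : Euc N, ind x * κ (x - y) = ind x * ∫⁻ h, κ h := by
      intro x
      rw [lintegral_const_mul _ (by fun_prop), lintegral_sub_left_eq_self κ x]
    simp_rw [this]
    rw [lintegral_mul_const _ hind, lintegral_indicator_one hB]
  have hsecond : ∫⁻ x : Euc N, ∫⁻ y : Euc N, ind y * κ (x - y)
      = volume B * ∫⁻ h, κ h := by
    rw [lintegral_lintegral_swap (by fun_prop)]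
    have : ∀ y : Euc N, ∫⁻ x : Euc N, ind y * κ (x - y) = ind y * ∫⁻ h, κ h := by
      intro y
      rw [lintegral_const_mul _ (by fun_prop), lintegral_sub_right_eq_self κ y]
    simp_rw [this]
    rw [lintegral_mul_const _ hind, lintegral_indicator_one hB]
  calc _ ≤ ∫⁻ x : Euc N, ∫⁻ y : Euc N, (ind x * κ (x - y) + ind y * κ (x - y)) :=
        lintegral_mono fun x => lintegral_mono fun y => hpt x y
    _ = ∫⁻ x : Euc N, (∫⁻ y : Euc N, ind x * κ (x - y)) + ∫⁻ y : Euc N, ind y * κ (x - y) := by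
        refine lintegral_congr fun x => lintegral_add_left (by fun_prop) _
    _ = _ := by
        rw [lintegral_add_left, hfirst, hsecond]
        · ring
        · exact Measurable.lintegral_prod_right' (f := fun p : Euc N × Euc N =>
            ind p.1 * κ (p.1 - p.2)) (by fun_prop)

lemma measurable_gagliardo_integrand (N : ℕ) (s : ℝ) {u : Euc N → ℝ} (hu : Measurable u) :
    Measurable (fun p : Euc N × Euc N =>
      ENNReal.ofReal ((u p.1 - u p.2) ^ 2 / ‖p.1 - p.2‖ ^ ((N : ℝ) + 2 * s))) := by
  fun_prop

lemma measurable_gagliardo_slice (N : ℕ) (s : ℝ) {u : Euc N → ℝ} (hu : Measurable u)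
    (x : Euc N) : Measurable (fun y : Euc N =>
      ENNReal.ofReal ((u x - u y) ^ 2 / ‖x - y‖ ^ ((N : ℝ) + 2 * s))) := by
  fun_prop

lemma gagliardo_congr_ae (N : ℕ) (s : ℝ) {u v : Euc N → ℝ} (h : u =ᵐ[volume] v) :
    gagliardo N s u = gagliardo N s v := by
  refine lintegral_congr_ae ?_
  filter_upwards [h] with x hx
  refine lintegral_congr_ae ?_
  filter_upwards [h] with y hy
  rw [hx, hy]

lemma gagliardo_const_mul (N : ℕ) (s c : ℝ) (u : Euc N → ℝ) :
    gagliardo N s (fun x => c * u x) = ENNReal.ofReal (c ^ 2) * gagliardo N s u := by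
  unfold gagliardo
  rw [← lintegral_const_mul' _ _ ENNReal.ofReal_ne_top]
  refine lintegral_congr fun x => ?_
  rw [← lintegral_const_mul' _ _ ENNReal.ofReal_ne_top]
  refine lintegral_congr fun y => ?_
  rw [← ENNReal.ofReal_mul (by positivity)]
  congr 1
  ring

/-- Localization formula for the partition of unity `cos ² + sin ² = 1`. -/
lemma gagliardo_cos_add_sin_le {N : ℕ} {s : ℝ} {w : Euc N → ℝ} (hw : Measurable w) {M : ℝ}
    (h0 : ∀ᵐ x, 0 ≤ w x) (hM : ∀ᵐ x, w x ≤ M) (x₀ : Euc N) {ρ : ℝ} (hρ : 0 < ρ) :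
    gagliardo N s (fun x => Real.cos (cutoffAngle N x₀ ρ x) * w x)
        + gagliardo N s (fun x => Real.sin (cutoffAngle N x₀ ρ x) * w x)
      ≤ gagliardo N s w
        + ENNReal.ofReal (M ^ 2)
          * (2 * volume (Metric.ball x₀ ρ) * ∫⁻ h, cutoffKernel N s ρ h) := by
  have hθ := measurable_cutoffAngle N x₀ ρ
  have hc : Measurable (fun x => Real.cos (cutoffAngle N x₀ ρ x) * w x) :=
    (Real.measurable_cos.comp hθ).mul hw
  have hmc := measurable_gagliardo_integrand N s hc
  have hmw := measurable_gagliardo_integrand N s hw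
  refine le_trans ?_ (add_le_add le_rfl
    (mul_le_mul' le_rfl (lintegral_cutoff_defect_le (s := s) x₀ hρ)))
  unfold gagliardo
  rw [← lintegral_const_mul' _ _ ENNReal.ofReal_ne_top, ← lintegral_add_left
    (Measurable.lintegral_prod_right' hmc), ← lintegral_add_left
    (Measurable.lintegral_prod_right' hmw)]
  refine lintegral_mono_ae ?_
  filter_upwards [h0, hM] with x hx0 hxM
  rw [← lintegral_const_mul' _ _ ENNReal.ofReal_ne_top, ← lintegral_add_left
    (measurable_gagliardo_slice N s hc x), ← lintegral_add_left (measurable_gagliardo_slice N s hw x)]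
  refine lintegral_mono_ae ?_
  filter_upwards [h0, hM] with y hy0 hyM
  have hcos := Real.cos_le_one (cutoffAngle N x₀ ρ x - cutoffAngle N x₀ ρ y)
  rw [← ENNReal.ofReal_mul (by positivity), ← ENNReal.ofReal_add (by positivity) (by positivity),
    ← ENNReal.ofReal_add (by positivity)
      (mul_nonneg (by positivity) (div_nonneg (by linarith) (by positivity)))]
  apply ENNReal.ofReal_le_ofReal
  rw [← mul_div_assoc, ← add_div, ← add_div]
  refine div_le_div_of_nonneg_right ?_ (by positivity)
  have hprod : w x * w y ≤ M ^ 2 := by nlinarith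
  have h1 := Real.cos_sq_add_sin_sq (cutoffAngle N x₀ ρ x)
  have h2 := Real.cos_sq_add_sin_sq (cutoffAngle N x₀ ρ y)
  have h3 := mul_le_mul_of_nonneg_right hprod
    (by linarith : 0 ≤ 2 * (1 - Real.cos (cutoffAngle N x₀ ρ x - cutoffAngle N x₀ ρ y)))
  refine le_trans (le_of_eq ?_) (add_le_add le_rfl h3)
  rw [Real.cos_sub]
  linear_combination (w x) ^ 2 * h1 + (w y) ^ 2 * h2

/-- Homogeneous form of the variational characterization of `λ₁`. -/
lemma lambda1_mul_le_gagliardo {N : ℕ} {s : ℝ} {Ω : Set (Euc N)} {u : Euc N → ℝ}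
    (hu : memK N s Ω u) {a : ℝ} (ha : 0 < a) (hau : a ≤ ∫ x in Ω, |u x| ^ (2 : ℝ)) :
    lambda1 N s 2 Ω * ENNReal.ofReal a ≤ gagliardo N s u := by
  set m := ∫ x in Ω, |u x| ^ (2 : ℝ) with hm
  have hm0 : 0 < m := ha.trans_le hau
  have hsq : (√m)⁻¹ ^ 2 = m⁻¹ := by rw [inv_pow, Real.sq_sqrt hm0.le]
  have hgag := gagliardo_const_mul N s (√m)⁻¹ u
  rw [hsq] at hgag
  have hle : lambda1 N s 2 Ω ≤ gagliardo N s (fun x => (√m)⁻¹ * u x) := by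
    refine iInf₂_le _ ⟨⟨hu.1.const_mul _, ?_, ?_⟩, ?_⟩
    · filter_upwards [hu.2.1] with x hx hxΩ
      rw [hx hxΩ, mul_zero]
    · rw [hgag]
      exact ENNReal.mul_lt_top ENNReal.ofReal_lt_top hu.2.2
    · have : ∀ x, |(√m)⁻¹ * u x| ^ (2 : ℝ) = m⁻¹ * |u x| ^ (2 : ℝ) := by
        intro x
        rw [abs_mul, Real.mul_rpow (abs_nonneg _) (abs_nonneg _), Real.rpow_two |(√m)⁻¹|, sq_abs,
          hsq]
      simp_rw [this]
      rw [integral_const_mul, ← hm, inv_mul_cancel₀ hm0.ne']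
  calc lambda1 N s 2 Ω * ENNReal.ofReal a
      ≤ (ENNReal.ofReal m⁻¹ * gagliardo N s u) * ENNReal.ofReal m :=
        mul_le_mul' (hle.trans_eq hgag) (ENNReal.ofReal_le_ofReal hau)
    _ = gagliardo N s u := by
        rw [mul_right_comm, ← ENNReal.ofReal_mul (by positivity), inv_mul_cancel₀ hm0.ne',
          ENNReal.ofReal_one, one_mul]

lemma memK_cos_mul_and_sin_mul {N : ℕ} (hN : 1 ≤ N) {s : ℝ} (hs : s ∈ Set.Ioo (0 : ℝ) 1)
    {Ω : Set (Euc N)} {w : Euc N → ℝ} (hw : memK N s Ω w) {M : ℝ}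
    (h0 : ∀ᵐ x, 0 ≤ w x) (hM : ∀ᵐ x, w x ≤ M) (x₀ : Euc N) {ρ : ℝ} (hρ : 0 < ρ) :
    memK N s Ω (fun x => Real.cos (cutoffAngle N x₀ ρ x) * w x) ∧
      memK N s Ω (fun x => Real.sin (cutoffAngle N x₀ ρ x) * w x) := by
  have hfin := (gagliardo_cos_add_sin_le (s := s) hw.1 h0 hM x₀ hρ).trans_lt (by
    refine ENNReal.add_lt_top.2 ⟨hw.2.2, ENNReal.mul_lt_top ENNReal.ofReal_lt_top ?_⟩
    refine ENNReal.mul_lt_top (ENNReal.mul_lt_top (by simp) measure_ball_lt_top) ?_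
    rw [lintegral_cutoffKernel hρ]
    exact ENNReal.mul_lt_top ENNReal.ofReal_lt_top (lintegral_cutoffKernel_one_lt_top hN hs))
  rw [ENNReal.add_lt_top] at hfin
  have hθ := measurable_cutoffAngle N x₀ ρ
  refine ⟨⟨(Real.measurable_cos.comp hθ).mul hw.1, ?_, hfin.1⟩,
    ⟨(Real.measurable_sin.comp hθ).mul hw.1, ?_, hfin.2⟩⟩ <;>
  · filter_upwards [hw.2.1] with x hx hxΩ
    rw [hx hxΩ, mul_zero]

/-- A lower bound on the mass of `w` in a ball bounds the energy of its localization. -/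
lemma lambda1_mul_le_gagliardo_cos {N : ℕ} (hN : 1 ≤ N) {s : ℝ} (hs : s ∈ Set.Ioo (0 : ℝ) 1)
    {Ω : Set (Euc N)} {w : Euc N → ℝ} (hw : memK N s Ω w) {M : ℝ}
    (h0 : ∀ᵐ x, 0 ≤ w x) (hM : ∀ᵐ x, w x ≤ M) (x₀ : Euc N) {ρ : ℝ} (hρ : 0 < ρ)
    {l m : ℝ} (hl : 0 < l) (hm : 0 < m)
    (hlm : ENNReal.ofReal m ≤ volume (Metric.ball x₀ (ρ / 2) ∩ {x | l < w x})) :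
    lambda1 N s 2 Ω * ENNReal.ofReal (l ^ 2 / 2 * m)
      ≤ gagliardo N s (fun x => Real.cos (cutoffAngle N x₀ ρ x) * w x) := by
  obtain ⟨hK, -⟩ := memK_cos_mul_and_sin_mul hN hs hw h0 hM x₀ hρ
  refine lambda1_mul_le_gagliardo hK (by positivity) ?_
  simp only [Real.rpow_two, sq_abs]
  set f : Euc N → ℝ := fun x => (Real.cos (cutoffAngle N x₀ ρ x) * w x) ^ 2 with hf
  have hfm : Measurable f := hK.1.pow_const 2
  rw [setIntegral_eq_integral_of_ae_compl_eq_zero (f := f) (by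
    filter_upwards [hK.2.1] with x hx hxΩ
    simp only [hf]
    rw [hx hxΩ]
    simp)]
  have hball : MeasurableSet (Metric.ball x₀ ρ) := measurableSet_ball
  have hfi : Integrable f := by
    have hg : Integrable ((Metric.ball x₀ ρ).indicator fun _ => M ^ 2) :=
      (integrable_indicator_iff hball).2 (integrableOn_const measure_ball_lt_top.ne)
    refine hg.mono' hfm.aestronglyMeasurable ?_
    filter_upwards [h0, hM] with x hx0 hxM
    rw [Real.norm_of_nonneg (by positivity)]
    by_cases hx : x ∈ Metric.ball x₀ ρ
    · rw [Set.indicator_of_mem hx]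
      simp only [hf]
      rw [mul_pow]
      have := Real.cos_sq_le_one (cutoffAngle N x₀ ρ x)
      have h3 : w x ^ 2 ≤ M ^ 2 := by gcongr
      nlinarith [sq_nonneg (w x)]
    · rw [Set.indicator_of_notMem hx]
      simp [hf, cutoffAngle_of_notMem N x₀ hρ hx]
  have hfnn : 0 ≤ᵐ[volume] f := Eventually.of_forall fun x => sq_nonneg _
  rw [← ENNReal.ofReal_le_ofReal_iff (integral_nonneg_of_ae hfnn),
    ofReal_integral_eq_lintegral_ofReal hfi hfnn, ENNReal.ofReal_mul (by positivity)]
  set S := Metric.ball x₀ (ρ / 2) ∩ {x | l < w x} with hS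
  have hSm : MeasurableSet S :=
    measurableSet_ball.inter (measurableSet_lt measurable_const hw.1)
  calc ENNReal.ofReal (l ^ 2 / 2) * ENNReal.ofReal m
      ≤ ENNReal.ofReal (l ^ 2 / 2) * volume S := by gcongr
    _ = ∫⁻ x, S.indicator (fun _ => ENNReal.ofReal (l ^ 2 / 2)) x :=
        (lintegral_indicator_const hSm _).symm
    _ ≤ ∫⁻ x, ENNReal.ofReal (f x) := by
        refine lintegral_mono fun x => ?_
        by_cases hx : x ∈ S
        · rw [Set.indicator_of_mem hx]
          apply ENNReal.ofReal_le_ofReal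
          have h1 := half_le_cos_cutoffAngle_sq N x₀ hρ hx.1
          have h2 : l ^ 2 ≤ w x ^ 2 := by
            have : l ≤ w x := hx.2.le
            gcongr
          simp only [hf]
          rw [mul_pow]
          nlinarith [sq_nonneg (w x)]
        · rw [Set.indicator_of_notMem hx]
          exact zero_le

/-- Truncation at height `k` gains energy from jumps between `{k < w}` and `{w ≤ k / 2}`. -/
lemma gagliardo_min_add_le {N : ℕ} {s : ℝ} (hs : 0 < s) {w : Euc N → ℝ} (hw : Measurable w)
    (hw0 : ∀ x, 0 ≤ w x) {k R m : ℝ} (hk : 0 < k) (hR : 0 < R) (hm : 0 ≤ m)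
    (hlevel : ∀ x, k < w x →
      ENNReal.ofReal m ≤ volume (Metric.ball x R ∩ {y | w y ≤ k / 2})) :
    gagliardo N s (fun x => min (w x) k)
        + ENNReal.ofReal (m * R ^ (-((N : ℝ) + 2 * s)))
          * ∫⁻ x, ENNReal.ofReal (w x * (w x - min (w x) k))
      ≤ gagliardo N s w := by
  have hmin : Measurable (fun x => min (w x) k) := hw.min measurable_const
  unfold gagliardo
  rw [← lintegral_const_mul' _ _ ENNReal.ofReal_ne_top,
    ← lintegral_add_left (Measurable.lintegral_prod_right'
      (measurable_gagliardo_integrand N s hmin))]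
  refine lintegral_mono fun x => ?_
  have hmono : ∀ y, ENNReal.ofReal ((min (w x) k - min (w y) k) ^ 2
        / ‖x - y‖ ^ ((N : ℝ) + 2 * s))
      ≤ ENNReal.ofReal ((w x - w y) ^ 2 / ‖x - y‖ ^ ((N : ℝ) + 2 * s)) := by
    intro y
    apply ENNReal.ofReal_le_ofReal
    refine div_le_div_of_nonneg_right (sq_le_sq.2 ?_) (by positivity)
    simpa using abs_min_sub_min_le_max (w x) k (w y) k
  rcases le_or_gt (w x) k with hx | hx
  · simp only [min_eq_left hx, sub_self, mul_zero, ENNReal.ofReal_zero, add_zero]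
    simpa only [min_eq_left hx] using lintegral_mono hmono
  · set S := Metric.ball x R ∩ {y | w y ≤ k / 2} with hS
    have hSm : MeasurableSet S := measurableSet_ball.inter (measurableSet_le hw measurable_const)
    set c := R ^ (-((N : ℝ) + 2 * s)) * (w x * (w x - min (w x) k)) with hc
    have hc0 : 0 ≤ c :=
      mul_nonneg (by positivity) (mul_nonneg (hw0 x) (sub_nonneg.2 (min_le_left _ _)))
    have hgain : ENNReal.ofReal (m * R ^ (-((N : ℝ) + 2 * s)))
          * ENNReal.ofReal (w x * (w x - min (w x) k))
        ≤ ∫⁻ y, S.indicator (fun _ => ENNReal.ofReal c) y := by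
      rw [lintegral_indicator_const hSm, ← ENNReal.ofReal_mul (by positivity), mul_assoc, ← hc,
        mul_comm, ENNReal.ofReal_mul hc0]
      exact mul_le_mul' le_rfl (hlevel x hx)
    refine (add_le_add le_rfl hgain).trans ?_
    rw [← lintegral_add_left (measurable_gagliardo_slice N s hmin x)]
    refine lintegral_mono fun y => ?_
    by_cases hy : y ∈ S
    · have hyk : w y ≤ k / 2 := hy.2
      have hxy : 0 < ‖x - y‖ := by
        rw [norm_sub_pos_iff]
        rintro rfl
        linarith
      have hdist : ‖x - y‖ ≤ R := by
        rw [← dist_eq_norm, dist_comm]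
        exact (Metric.mem_ball.1 hy.1).le
      have hker : R ^ (-((N : ℝ) + 2 * s)) ≤ (‖x - y‖ ^ ((N : ℝ) + 2 * s))⁻¹ := by
        rw [Real.rpow_neg hR.le]
        gcongr
      rw [Set.indicator_of_mem hy, ← ENNReal.ofReal_add (by positivity) hc0]
      apply ENNReal.ofReal_le_ofReal
      rw [hc, min_eq_right hx.le, min_eq_left (by linarith : w y ≤ k)]
      have hprod : 0 ≤ w x * (w x - k) := mul_nonneg (hw0 x) (by linarith)
      have h1 := mul_le_mul_of_nonneg_right hker hprod
      have h2 : (k - w y) ^ 2 + w x * (w x - k) ≤ (w x - w y) ^ 2 := by nlinarith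
      calc _ ≤ (k - w y) ^ 2 / ‖x - y‖ ^ ((N : ℝ) + 2 * s)
            + (‖x - y‖ ^ ((N : ℝ) + 2 * s))⁻¹ * (w x * (w x - k)) := by gcongr
        _ = ((k - w y) ^ 2 + w x * (w x - k)) / ‖x - y‖ ^ ((N : ℝ) + 2 * s) := by ring
        _ ≤ _ := div_le_div_of_nonneg_right h2 (by positivity)
    · rw [Set.indicator_of_notMem hy, add_zero]
      exact hmono y

lemma rpow_sub_min_rpow_le {q : ℝ} (hq : q ∈ Set.Ioo (1 : ℝ) 2) {a k : ℝ} (ha : 0 ≤ a)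
    (hk : 0 < k) : a ^ q - min a k ^ q ≤ q * (k ^ (q - 2) * (a * (a - min a k))) := by
  rcases le_or_gt a k with h | h
  · simp [min_eq_left h]
  · rw [min_eq_right h.le]
    have ha0 : 0 < a := hk.trans h
    have hbern := one_add_mul_self_le_rpow_one_add (s := k / a - 1)
      (by have : 0 ≤ k / a := by positivity
          linarith) hq.1.le
    rw [add_sub_cancel, Real.div_rpow hk.le ha] at hbern
    have hpow : a ^ q = a ^ (q - 2) * a * a := by
      rw [← Real.rpow_add_one ha0.ne', ← Real.rpow_add_one ha0.ne']
      congr 1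
      ring
    have hmono : a ^ (q - 2) ≤ k ^ (q - 2) :=
      Real.rpow_le_rpow_of_nonpos hk h.le (by linarith [hq.2])
    have h1 : (1 + q * (k / a - 1)) * a ^ q ≤ k ^ q := by
      rwa [le_div_iff₀ (by positivity)] at hbern
    have h2 : (1 + q * (k / a - 1)) * a ^ q = a ^ q - q * (a ^ (q - 2) * (a * (a - k))) := by
      rw [hpow]
      field_simp
      ring
    have h3 : q * (a ^ (q - 2) * (a * (a - k))) ≤ q * (k ^ (q - 2) * (a * (a - k))) := by
      have : 0 ≤ a - k := by linarith
      have := hq.1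
      gcongr
    linarith

/-- A Lane–Emden density cannot exceed a level `k` if, near every point of `{k < w}`, it is at most
`k / 2` on a large portion of a ball. -/
lemma isLaneEmden.ae_le_of_level {N : ℕ} {s : ℝ} (hs : 0 < s) {q : ℝ}
    (hq : q ∈ Set.Ioo (1 : ℝ) 2) {Ω : Set (Euc N)} {w : Euc N → ℝ}
    (hLE : isLaneEmden N s q Ω w) (hw0 : ∀ x, 0 ≤ w x)
    (hint : IntegrableOn (fun x => w x ^ q) Ω) {k R m : ℝ} (hk : 0 < k) (hR : 0 < R)
    (hm : 2 * k ^ (q - 2) < m * R ^ (-((N : ℝ) + 2 * s)))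
    (hlevel : ∀ x, k < w x →
      ENNReal.ofReal m ≤ volume (Metric.ball x R ∩ {y | w y ≤ k / 2})) :
    ∀ᵐ x, w x ≤ k := by
  obtain ⟨⟨hw, hwΩ, hwfin⟩, -, hopt⟩ := hLE
  have hRpos : 0 < R ^ (-((N : ℝ) + 2 * s)) := by positivity
  have hm0 : 0 < m := by
    have : 0 < 2 * k ^ (q - 2) := by positivity
    exact pos_of_mul_pos_left (this.trans hm) hRpos.le
  set Λ := m * R ^ (-((N : ℝ) + 2 * s)) with hΛ
  have hΛ0 : 0 < Λ := mul_pos hm0 hRpos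
  have hgain := gagliardo_min_add_le hs hw hw0 hk hR hm0.le hlevel
  set φ : Euc N → ℝ := fun x => min (w x) k with hφ
  set g : Euc N → ℝ := fun x => w x * (w x - φ x) with hg
  have hφm : Measurable φ := hw.min measurable_const
  have hφ0 : ∀ x, 0 ≤ φ x := fun x => le_min (hw0 x) hk.le
  have hg0 : ∀ x, 0 ≤ g x := fun x => mul_nonneg (hw0 x) (sub_nonneg.2 (min_le_left _ _))
  have hgm : Measurable g := hw.mul (hw.sub hφm)
  have hφfin : gagliardo N s φ < ⊤ := (le_self_add.trans hgain).trans_lt hwfin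
  have hSfin : ∫⁻ x, ENNReal.ofReal (g x) ≠ ⊤ := by
    intro htop
    have : ENNReal.ofReal Λ * ∫⁻ x, ENNReal.ofReal (g x) < ⊤ :=
      (le_add_self.trans hgain).trans_lt hwfin
    rw [htop, ENNReal.mul_top (by simpa using hΛ0)] at this
    exact lt_irrefl _ this
  have hgi : Integrable g :=
    ⟨hgm.aestronglyMeasurable, (hasFiniteIntegral_iff_ofReal (Eventually.of_forall hg0)).2
      hSfin.lt_top⟩
  have hreal : (gagliardo N s φ).toReal + Λ * ∫ x, g x ≤ (gagliardo N s w).toReal := by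
    have hS := ofReal_integral_eq_lintegral_ofReal hgi (Eventually.of_forall hg0)
    rw [← hS, ← ENNReal.ofReal_mul hΛ0.le] at hgain
    have := ENNReal.toReal_mono hwfin.ne hgain
    rwa [ENNReal.toReal_add hφfin.ne ENNReal.ofReal_ne_top, ENNReal.toReal_ofReal
      (mul_nonneg hΛ0.le (integral_nonneg hg0))] at this
  have hq0 : 0 < q := by linarith [hq.1]
  have hφK : memK N s Ω φ := by
    refine ⟨hφm, ?_, hφfin⟩
    filter_upwards [hwΩ] with x hx hxΩ
    simp [hφ, hx hxΩ, hk.le]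
  have hφint : IntegrableOn (fun x => φ x ^ q) Ω := by
    refine Integrable.mono' hint (hφm.pow_const q).aestronglyMeasurable ?_
    refine Eventually.of_forall fun x => ?_
    rw [Real.norm_of_nonneg (Real.rpow_nonneg (hφ0 x) q)]
    exact Real.rpow_le_rpow (hφ0 x) (min_le_left _ _) hq0.le
  have henergy := hopt φ hφK (Eventually.of_forall hφ0)
  unfold freeEnergy at henergy
  have hdiff : (∫ x in Ω, w x ^ q) - ∫ x in Ω, φ x ^ q
      ≤ q * (k ^ (q - 2) * ∫ x, g x) := by
    rw [← integral_sub hint hφint]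
    calc ∫ x in Ω, (w x ^ q - φ x ^ q) ≤ ∫ x in Ω, q * (k ^ (q - 2) * g x) :=
          integral_mono (hint.sub hφint) ((hgi.integrableOn.const_mul _).const_mul _)
            fun x => rpow_sub_min_rpow_le hq (hw0 x) hk
      _ = q * (k ^ (q - 2) * ∫ x in Ω, g x) := by rw [integral_const_mul, integral_const_mul]
      _ ≤ _ := by
          have := setIntegral_le_integral (s := Ω) hgi (Eventually.of_forall hg0)
          gcongr
  have hdiff' := mul_le_mul_of_nonneg_left hdiff (by positivity : 0 ≤ 1 / q)
  have heq : 1 / q * (q * (k ^ (q - 2) * ∫ x, g x)) = k ^ (q - 2) * ∫ x, g x := by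
    field_simp
  rw [heq, mul_sub] at hdiff'
  have hT0 : 0 ≤ ∫ x, g x := integral_nonneg hg0
  have hTz : ∫ x, g x = 0 := by
    by_contra hne
    have hpos : 0 < ∫ x, g x := lt_of_le_of_ne hT0 (Ne.symm hne)
    have := mul_lt_mul_of_pos_right hm hpos
    linarith
  have hz := (integral_eq_zero_iff_of_nonneg hg0 hgi).1 hTz
  filter_upwards [hz] with x hx
  by_contra! hlt
  have : 0 < g x := by
    simp only [hg, hφ, min_eq_right hlt.le]
    exact mul_pos (hk.trans hlt) (by linarith)
  exact this.ne' hx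

/-- If a Lane–Emden density exceeds the level `k`, it is at least `k / 2` on half of some ball at
the natural scale of that level. -/
lemma isLaneEmden.exists_ball_of_not_ae_le {N : ℕ} {s : ℝ} (hs : 0 < s) {q : ℝ}
    (hq : q ∈ Set.Ioo (1 : ℝ) 2) {Ω : Set (Euc N)} {w : Euc N → ℝ}
    (hLE : isLaneEmden N s q Ω w) (hw0 : ∀ x, 0 ≤ w x)
    (hint : IntegrableOn (fun x => w x ^ q) Ω) {k R ω : ℝ} (hk : 0 < k) (hR : 0 < R)
    (hω : ω = (volume (Metric.ball (0 : Euc N) 1)).toReal)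
    (hRk : R ^ (2 * s) = k ^ (2 - q) * ω / 8) (hnot : ¬ ∀ᵐ x, w x ≤ k) :
    ∃ x, ENNReal.ofReal (R ^ (N : ℝ) * ω / 2)
      ≤ volume (Metric.ball x R ∩ {y | k / 2 < w y}) := by
  have hω0 : 0 < ω := hω ▸ ENNReal.toReal_pos (Metric.measure_ball_pos _ _ one_pos).ne'
    measure_ball_lt_top.ne
  have hm : 2 * k ^ (q - 2) < R ^ (N : ℝ) * ω / 2 * R ^ (-((N : ℝ) + 2 * s)) := by
    have h1 : R ^ (N : ℝ) * R ^ (-((N : ℝ) + 2 * s)) = (R ^ (2 * s))⁻¹ := by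
      rw [← Real.rpow_add hR, ← Real.rpow_neg hR.le]
      congr 1
      ring
    have h2 : k ^ (q - 2) = (k ^ (2 - q))⁻¹ := by
      rw [← Real.rpow_neg hk.le]
      congr 1
      ring
    have h3 : 0 < k ^ (2 - q) := by positivity
    have h4 : (k ^ (2 - q) * ω / 8)⁻¹ * (ω / 2) = 4 * (k ^ (2 - q))⁻¹ := by
      field_simp
      norm_num
    have h5 : R ^ (N : ℝ) * ω / 2 * R ^ (-((N : ℝ) + 2 * s))
        = R ^ (N : ℝ) * R ^ (-((N : ℝ) + 2 * s)) * (ω / 2) := by ring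
    rw [h5, h1, hRk, h4, h2]
    have := inv_pos.2 h3
    linarith
  by_contra! hcon
  refine hnot (hLE.ae_le_of_level hs hq hw0 hint hk hR hm fun x _ => ?_)
  by_contra! hlt
  have hsum : volume (Metric.ball x R) ≤ volume (Metric.ball x R ∩ {y | w y ≤ k / 2})
      + volume (Metric.ball x R ∩ {y | k / 2 < w y}) := by
    refine (measure_mono fun y hy => ?_).trans (measure_union_le _ _)
    rcases le_or_gt (w y) (k / 2) with h | h
    · exact Or.inl ⟨hy, h⟩
    · exact Or.inr ⟨hy, h⟩
  have hlt2 := hsum.trans_lt (ENNReal.add_lt_add hlt (hcon x))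
  rw [← ENNReal.ofReal_add (by positivity) (by positivity), add_halves,
    volume_euc_ball N x hR, ← hω] at hlt2
  exact lt_irrefl _ hlt2

lemma unitBall_volume_toReal_pos (N : ℕ) :
    0 < (volume (Metric.ball (0 : Euc N) 1)).toReal :=
  ENNReal.toReal_pos (Metric.measure_ball_pos _ _ one_pos).ne' measure_ball_lt_top.ne

lemma exists_natural_scale {s : ℝ} (hs : 0 < s) {a : ℝ} (ha : 0 < a) :
    ∃ R : ℝ, 0 < R ∧ R ^ (2 * s) = a := by
  refine ⟨a ^ (2 * s)⁻¹, by positivity, ?_⟩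
  rw [← Real.rpow_mul ha.le, inv_mul_cancel₀ (by positivity), Real.rpow_one]

/-- Qualitative boundedness of Lane–Emden densities. -/
lemma isLaneEmden.exists_ae_le {N : ℕ} {s : ℝ} (hs : 0 < s) {q : ℝ}
    (hq : q ∈ Set.Ioo (1 : ℝ) 2) {Ω : Set (Euc N)} {w : Euc N → ℝ}
    (hLE : isLaneEmden N s q Ω w) (hw0 : ∀ x, 0 ≤ w x)
    (hint : IntegrableOn (fun x => w x ^ q) Ω) : ∃ M, ∀ᵐ x, w x ≤ M := by
  by_contra hcon
  set ω := (volume (Metric.ball (0 : Euc N) 1)).toReal with hω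
  have hω0 : 0 < ω := unitBall_volume_toReal_pos N
  have hq0 : 0 < q := by linarith [hq.1]
  have hint' : Integrable (fun x => w x ^ q) := by
    rw [← integrableOn_univ]
    refine hint.of_ae_sdiff_eq_zero MeasurableSet.univ.nullMeasurableSet ?_
    filter_upwards [hLE.1.2.1] with x hx hxΩ
    rw [hx hxΩ.2, Real.zero_rpow hq0.ne']
  set I := ∫ x, w x ^ q with hI
  have hwq0 : ∀ x, 0 ≤ w x ^ q := fun x => Real.rpow_nonneg (hw0 x) q
  obtain ⟨k, hk2, hkI, hkω⟩ := ((eventually_ge_atTop (2 : ℝ)).and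
    ((eventually_gt_atTop (4 * I / ω)).and ((tendsto_rpow_atTop
      (by linarith [hq.2] : 0 < 2 - q)).eventually_ge_atTop (8 / ω)))).exists
  have hk0 : 0 < k := by linarith
  obtain ⟨R, hR, hRk⟩ := exists_natural_scale hs
    (by positivity : 0 < k ^ (2 - q) * ω / 8)
  obtain ⟨x, hx⟩ := hLE.exists_ball_of_not_ae_le hs hq hw0 hint hk0 hR hω hRk
    fun h => hcon ⟨k, h⟩
  have hR1 : 1 ≤ R := by
    by_contra! hlt
    have h1 : R ^ (2 * s) < 1 := Real.rpow_lt_one hR.le hlt (by positivity)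
    rw [div_le_iff₀ hω0] at hkω
    linarith
  have hRN : 1 ≤ R ^ (N : ℝ) := Real.one_le_rpow hR1 (by positivity)
  have hkq : k / 2 ≤ (k / 2) ^ q := by
    have := Real.rpow_le_rpow_of_exponent_le (by linarith : 1 ≤ k / 2) hq.1.le
    rwa [Real.rpow_one] at this
  have hmarkov : ENNReal.ofReal ((k / 2) ^ q) * ENNReal.ofReal (R ^ (N : ℝ) * ω / 2)
      ≤ ENNReal.ofReal I := by
    rw [hI, ofReal_integral_eq_lintegral_ofReal hint' (Eventually.of_forall hwq0)]
    refine le_trans (mul_le_mul' le_rfl (hx.trans (measure_mono ?_)))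
      (mul_meas_ge_le_lintegral ((hLE.1.1.pow_const q).ennreal_ofReal) _)
    intro y hy
    exact ENNReal.ofReal_le_ofReal (Real.rpow_le_rpow (by positivity) hy.2.le hq0.le)
  rw [← ENNReal.ofReal_mul (by positivity),
    ENNReal.ofReal_le_ofReal_iff (integral_nonneg hwq0)] at hmarkov
  have h1 : k / 2 * (ω / 2) ≤ (k / 2) ^ q * (R ^ (N : ℝ) * ω / 2) := by
    gcongr
    nlinarith
  rw [div_lt_iff₀ hω0] at hkI
  nlinarith

lemma localization_error_eq {N : ℕ} (hN : 1 ≤ N) {s : ℝ} (hs : s ∈ Set.Ioo (0 : ℝ) 1)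
    (x₀ : Euc N) {ρ : ℝ} (hρ : 0 < ρ) (M : ℝ) :
    ENNReal.ofReal (M ^ 2) * (2 * volume (Metric.ball x₀ ρ) * ∫⁻ h, cutoffKernel N s ρ h)
      = ENNReal.ofReal (M ^ 2 * (2 * (ρ ^ (N : ℝ) * (volume (Metric.ball (0 : Euc N) 1)).toReal)
          * (ρ ^ (-(2 * s)) * (∫⁻ h, cutoffKernel N s 1 h).toReal))) := by
  have hω := unitBall_volume_toReal_pos N
  rw [volume_euc_ball N x₀ hρ, lintegral_cutoffKernel hρ, ENNReal.ofReal_mul (by positivity),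
    ENNReal.ofReal_mul (p := M ^ 2) (by positivity),
    ENNReal.ofReal_mul (p := 2 * _) (by positivity), ENNReal.ofReal_mul (p := 2) (by positivity),
    ENNReal.ofReal_mul (p := ρ ^ (N : ℝ)) (by positivity),
    ENNReal.ofReal_mul (p := ρ ^ (-(2 * s))) (by positivity),
    ENNReal.ofReal_toReal (lintegral_cutoffKernel_one_lt_top hN hs).ne]
  simp

/-- Energy of the localization of a bounded Lane–Emden density, obtained by comparison with the
complementary localization. -/
lemma isLaneEmden.gagliardo_cos_le {N : ℕ} (hN : 1 ≤ N) {s : ℝ} (hs : s ∈ Set.Ioo (0 : ℝ) 1)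
    {q : ℝ} (hq : q ∈ Set.Ioo (1 : ℝ) 2) {Ω : Set (Euc N)} {w : Euc N → ℝ}
    (hLE : isLaneEmden N s q Ω w) (hw0 : ∀ x, 0 ≤ w x)
    (hint : IntegrableOn (fun x => w x ^ q) Ω) {M : ℝ} (hM0 : 0 ≤ M) (hM : ∀ᵐ x, w x ≤ M)
    (x₀ : Euc N) {ρ : ℝ} (hρ : 0 < ρ) :
    gagliardo N s (fun x => Real.cos (cutoffAngle N x₀ ρ x) * w x)
      ≤ ENNReal.ofReal (M ^ 2 * (2 * (ρ ^ (N : ℝ) * (volume (Metric.ball (0 : Euc N) 1)).toReal)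
          * (ρ ^ (-(2 * s)) * (∫⁻ h, cutoffKernel N s 1 h).toReal))
          + 2 * (M ^ q * (ρ ^ (N : ℝ) * (volume (Metric.ball (0 : Euc N) 1)).toReal))) := by
  obtain ⟨hcK, hsK⟩ :=
    memK_cos_mul_and_sin_mul hN hs hLE.1 (Eventually.of_forall hw0) hM x₀ hρ
  have hloc := gagliardo_cos_add_sin_le (s := s) hLE.1.1 (Eventually.of_forall hw0) hM x₀ hρ
  rw [localization_error_eq hN hs x₀ hρ M] at hloc
  set ω := (volume (Metric.ball (0 : Euc N) 1)).toReal with hω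
  have hω0 : 0 < ω := unitBall_volume_toReal_pos N
  set K := (∫⁻ h, cutoffKernel N s 1 h).toReal with hK
  have hK0 : 0 ≤ K := ENNReal.toReal_nonneg
  set D := M ^ 2 * (2 * (ρ ^ (N : ℝ) * ω) * (ρ ^ (-(2 * s)) * K)) with hD
  have hD0 : 0 ≤ D := by positivity
  set η : Euc N → ℝ := fun x => Real.cos (cutoffAngle N x₀ ρ x) * w x with hη
  set ζ : Euc N → ℝ := fun x => Real.sin (cutoffAngle N x₀ ρ x) * w x with hζ
  have hwfin := hLE.1.2.2
  have hq0 : 0 < q := by linarith [hq.1]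
  have hsin : ∀ x, 0 ≤ Real.sin (cutoffAngle N x₀ ρ x) := fun x => by
    have := cutoffAngle_mem N x₀ hρ x
    exact Real.sin_nonneg_of_nonneg_of_le_pi this.1 (by linarith [this.2, Real.pi_pos])
  have hζ0 : ∀ x, 0 ≤ ζ x := fun x => mul_nonneg (hsin x) (hw0 x)
  have hζint : IntegrableOn (fun x => ζ x ^ q) Ω := by
    refine Integrable.mono' hint (hsK.1.pow_const q).aestronglyMeasurable ?_
    refine Eventually.of_forall fun x => ?_
    rw [Real.norm_of_nonneg (Real.rpow_nonneg (hζ0 x) q)]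
    refine Real.rpow_le_rpow (hζ0 x) ?_ hq0.le
    exact mul_le_of_le_one_left (hw0 x) (Real.sin_le_one _)
  have hball : MeasurableSet (Metric.ball x₀ ρ) := measurableSet_ball
  have hgi : Integrable ((Metric.ball x₀ ρ).indicator fun _ => M ^ q) :=
    (integrable_indicator_iff hball).2 (integrableOn_const measure_ball_lt_top.ne)
  have hdiff : (∫ x in Ω, w x ^ q) - ∫ x in Ω, ζ x ^ q ≤ M ^ q * (ρ ^ (N : ℝ) * ω) := by
    rw [← integral_sub hint hζint]
    calc ∫ x in Ω, (w x ^ q - ζ x ^ q)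
        ≤ ∫ x in Ω, (Metric.ball x₀ ρ).indicator (fun _ => M ^ q) x := by
          refine integral_mono_ae (hint.sub hζint) hgi.integrableOn ?_
          filter_upwards [ae_restrict_of_ae hM] with x hxM
          by_cases hx : x ∈ Metric.ball x₀ ρ
          · rw [Set.indicator_of_mem hx]
            have h1 : w x ^ q ≤ M ^ q := Real.rpow_le_rpow (hw0 x) hxM hq0.le
            have h2 : 0 ≤ ζ x ^ q := Real.rpow_nonneg (hζ0 x) q
            linarith
          · rw [Set.indicator_of_notMem hx]
            simp [hζ, cutoffAngle_of_notMem N x₀ hρ hx]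
      _ ≤ ∫ x, (Metric.ball x₀ ρ).indicator (fun _ => M ^ q) x :=
          setIntegral_le_integral hgi (Eventually.of_forall fun x =>
            Set.indicator_nonneg (fun _ _ => by positivity) x)
      _ = M ^ q * (ρ ^ (N : ℝ) * ω) := by
          rw [integral_indicator_const _ hball, measureReal_def, volume_euc_ball N x₀ hρ,
            ENNReal.toReal_ofReal (by positivity), smul_eq_mul, mul_comm]
  have henergy := hLE.2.2 ζ hsK (Eventually.of_forall hζ0)
  unfold freeEnergy at henergy
  have hlocR := ENNReal.toReal_mono (ENNReal.add_ne_top.2 ⟨hwfin.ne, ENNReal.ofReal_ne_top⟩) hloc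
  rw [ENNReal.toReal_add hcK.2.2.ne hsK.2.2.ne, ENNReal.toReal_add hwfin.ne
    ENNReal.ofReal_ne_top, ENNReal.toReal_ofReal hD0] at hlocR
  rw [← ENNReal.ofReal_toReal hcK.2.2.ne]
  apply ENNReal.ofReal_le_ofReal
  set P := M ^ q * (ρ ^ (N : ℝ) * ω) with hP
  have hP0 : 0 ≤ P := by positivity
  have hfrac : 1 / q * ((∫ x in Ω, w x ^ q) - ∫ x in Ω, ζ x ^ q) ≤ P := by
    have h1 : 1 / q ≤ 1 := by
      rw [div_le_one hq0]
      exact hq.1.le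
    calc _ ≤ 1 / q * P := by gcongr
      _ ≤ 1 * P := by gcongr
      _ = P := one_mul P
  linarith

/-- Universal constant bounding `λ₁` at a level that is comparable to the supremum. -/
def levelConst (N : ℕ) (s q : ℝ) : ℝ :=
  1024 * 2 ^ (N : ℝ) * 2 ^ (-(2 * s)) * (∫⁻ h, cutoffKernel N s 1 h).toReal
      / (volume (Metric.ball (0 : Euc N) 1)).toReal
    + 32 * 2 ^ q * 2 ^ (N : ℝ)

lemma levelConst_pos (N : ℕ) (s q : ℝ) : 0 < levelConst N s q := by
  have hω := unitBall_volume_toReal_pos N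
  have hK : 0 ≤ (∫⁻ h, cutoffKernel N s 1 h).toReal := ENNReal.toReal_nonneg
  unfold levelConst
  positivity

lemma isLaneEmden.lambda1_le_of_level {N : ℕ} (hN : 1 ≤ N) {s : ℝ}
    (hs : s ∈ Set.Ioo (0 : ℝ) 1) {q : ℝ} (hq : q ∈ Set.Ioo (1 : ℝ) 2) {Ω : Set (Euc N)}
    {w : Euc N → ℝ} (hLE : isLaneEmden N s q Ω w) (hw0 : ∀ x, 0 ≤ w x)
    (hint : IntegrableOn (fun x => w x ^ q) Ω) {k : ℝ} (hk : 0 < k)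
    (hM : ∀ᵐ x, w x ≤ 2 * k) (hnot : ¬ ∀ᵐ x, w x ≤ k) :
    lambda1 N s 2 Ω ≤ ENNReal.ofReal (levelConst N s q * k ^ (q - 2)) := by
  have hω0 := unitBall_volume_toReal_pos N
  obtain ⟨R, hR, hRk⟩ := exists_natural_scale hs.1
    (by positivity :
      0 < k ^ (2 - q) * (volume (Metric.ball (0 : Euc N) 1)).toReal / 8)
  obtain ⟨x₀, hx₀⟩ := hLE.exists_ball_of_not_ae_le hs.1 hq hw0 hint hk hR rfl hRk hnot
  have hρ : 0 < 2 * R := by positivity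
  have hlow := lambda1_mul_le_gagliardo_cos hN hs hLE.1 (Eventually.of_forall hw0) hM x₀ hρ
    (l := k / 2) (m := R ^ (N : ℝ) * (volume (Metric.ball (0 : Euc N) 1)).toReal / 2)
    (by positivity) (by positivity) (by rwa [mul_div_cancel_left₀ R two_ne_zero])
  have hup := hLE.gagliardo_cos_le hN hs hq hw0 hint (by positivity) hM x₀ hρ
  have h := hlow.trans hup
  unfold levelConst
  set ω := (volume (Metric.ball (0 : Euc N) 1)).toReal with hω
  set K := (∫⁻ h, cutoffKernel N s 1 h).toReal with hK
  have ha : 0 < (k / 2) ^ 2 / 2 * (R ^ (N : ℝ) * ω / 2) := by positivity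
  rw [← ENNReal.le_div_iff_mul_le (Or.inl (by simpa using ha)) (Or.inl ENNReal.ofReal_ne_top),
    ← ENNReal.ofReal_div_of_pos ha] at h
  refine h.trans_eq ?_
  congr 1
  have hR2 : R ^ (-(2 * s)) = 8 * k ^ (q - 2) / ω := by
    rw [Real.rpow_neg hR.le, hRk, show q - 2 = -(2 - q) by ring, Real.rpow_neg hk.le]
    field_simp
  have hkq : k ^ q = k ^ (q - 2) * k ^ 2 := by
    rw [← Real.rpow_two, ← Real.rpow_add hk]
    congr 1
    ring
  rw [Real.mul_rpow two_pos.le hR.le, Real.mul_rpow two_pos.le hR.le,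
    Real.mul_rpow two_pos.le hk.le, hR2, hkq]
  have : R ^ (N : ℝ) ≠ 0 := by positivity
  field_simp
  ring

/-- Lane–Emden densities have finite `L^q` norm as soon as `λ₁` is positive. -/
lemma isLaneEmden.integrableOn_rpow {N : ℕ} (hN : 1 ≤ N) {s : ℝ} (hs : s ∈ Set.Ioo (0 : ℝ) 1)
    {q : ℝ} (hq : q ∈ Set.Ioo (1 : ℝ) 2) {Ω : Set (Euc N)} (hΩ : 0 < lambda1 N s 2 Ω)
    {w : Euc N → ℝ} (hLE : isLaneEmden N s q Ω w) (hw0 : ∀ x, 0 ≤ w x) :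
    IntegrableOn (fun x => w x ^ q) Ω := by
  by_contra hnint
  have hq0 : 0 < q := by linarith [hq.1]
  have hzero : gagliardo N s (fun _ => (0 : ℝ)) = 0 := by simp [gagliardo]
  have henergy := hLE.2.2 (fun _ => 0)
    ⟨measurable_const, Eventually.of_forall fun _ _ => rfl, by rw [hzero]; simp⟩
    (Eventually.of_forall fun _ => le_rfl)
  unfold freeEnergy at henergy
  rw [integral_undef hnint, hzero] at henergy
  simp only [Real.zero_rpow hq0.ne', integral_zero, ENNReal.toReal_zero] at henergy
  have hgw : gagliardo N s w = 0 := by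
    have h0 : (gagliardo N s w).toReal = 0 :=
      le_antisymm (by linarith) ENNReal.toReal_nonneg
    exact ((ENNReal.toReal_eq_zero_iff _).1 h0).resolve_right hLE.1.2.2.ne
  have hconst : ∃ c, ∀ᵐ x, w x = c := by
    have h1 := (lintegral_eq_zero_iff (Measurable.lintegral_prod_right'
      (measurable_gagliardo_integrand N s hLE.1.1))).1 hgw
    obtain ⟨x, hx⟩ := h1.exists
    have h2 := (lintegral_eq_zero_iff (measurable_gagliardo_slice N s hLE.1.1 x)).1 hx
    refine ⟨w x, ?_⟩
    filter_upwards [h2] with y hy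
    by_contra hne
    have hxy : 0 < ‖x - y‖ := by
      rw [norm_sub_pos_iff]
      rintro rfl
      exact hne rfl
    have hsq : 0 < (w x - w y) ^ 2 := by
      have : w x - w y ≠ 0 := sub_ne_zero.2 (Ne.symm hne)
      positivity
    have hpos : 0 < (w x - w y) ^ 2 / ‖x - y‖ ^ ((N : ℝ) + 2 * s) := by positivity
    exact absurd (ENNReal.ofReal_eq_zero.1 hy) (not_le.2 hpos)
  obtain ⟨c, hc⟩ := hconst
  have hc0 : 0 < c := by
    rcases lt_or_ge 0 c with h | h
    · exact h
    · refine absurd ?_ hnint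
      refine (integrable_zero _ _ _).congr ?_
      filter_upwards [ae_restrict_of_ae hc] with x hx
      have : w x = 0 := le_antisymm (hx ▸ h) (hw0 x)
      simp [this, Real.zero_rpow hq0.ne']
  have hω0 := unitBall_volume_toReal_pos N
  have hbound : ∀ ρ : ℝ, 0 < ρ → lambda1 N s 2 Ω ≤ ENNReal.ofReal
      (16 * 2 ^ (N : ℝ) * (∫⁻ h, cutoffKernel N s 1 h).toReal * ρ ^ (-(2 * s))) := by
    intro ρ hρ
    have hM : ∀ᵐ x, w x ≤ c := hc.mono fun x hx => hx.le
    have hvol : ENNReal.ofReal ((ρ / 2) ^ (N : ℝ) * (volume (Metric.ball (0 : Euc N) 1)).toReal)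
        ≤ volume (Metric.ball (0 : Euc N) (ρ / 2) ∩ {x | c / 2 < w x}) := by
      rw [← volume_euc_ball N 0 (by positivity : 0 < ρ / 2)]
      refine measure_mono_ae ?_
      filter_upwards [hc] with x hx hxB
      refine ⟨hxB, ?_⟩
      change c / 2 < w x
      linarith
    have hlow := lambda1_mul_le_gagliardo_cos hN hs hLE.1 (Eventually.of_forall hw0) hM 0 hρ
      (l := c / 2) (by positivity) (by positivity) hvol
    have hup := gagliardo_cos_add_sin_le (s := s) hLE.1.1 (Eventually.of_forall hw0) hM 0 hρ
    rw [localization_error_eq hN hs 0 hρ, hgw, zero_add] at hup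
    have h := hlow.trans (le_self_add.trans hup)
    set ω := (volume (Metric.ball (0 : Euc N) 1)).toReal with hω
    have ha : 0 < (c / 2) ^ 2 / 2 * ((ρ / 2) ^ (N : ℝ) * ω) := by positivity
    rw [← ENNReal.le_div_iff_mul_le (Or.inl (by simpa using ha)) (Or.inl ENNReal.ofReal_ne_top),
      ← ENNReal.ofReal_div_of_pos ha] at h
    refine h.trans_eq ?_
    congr 1
    rw [Real.div_rpow hρ.le two_pos.le]
    have : ρ ^ (N : ℝ) ≠ 0 := by positivity
    field_simp
    ring
  have hlim : Tendsto (fun ρ : ℝ => ENNReal.ofReal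
      (16 * 2 ^ (N : ℝ) * (∫⁻ h, cutoffKernel N s 1 h).toReal * ρ ^ (-(2 * s)))) atTop (𝓝 0) := by
    have h1 := (tendsto_rpow_neg_atTop (by linarith [hs.1] : 0 < 2 * s)).const_mul
      (16 * 2 ^ (N : ℝ) * (∫⁻ h, cutoffKernel N s 1 h).toReal)
    rw [mul_zero] at h1
    simpa using ENNReal.tendsto_ofReal h1
  exact hΩ.not_ge (ge_of_tendsto hlim ((eventually_gt_atTop 0).mono hbound))

lemma isLaneEmden.congr_ae {N : ℕ} {s q : ℝ} {Ω : Set (Euc N)} {w v : Euc N → ℝ}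
    (hLE : isLaneEmden N s q Ω w) (hv : Measurable v) (h : w =ᵐ[volume] v) :
    isLaneEmden N s q Ω v := by
  have hg := gagliardo_congr_ae N s h
  refine ⟨⟨hv, ?_, hg ▸ hLE.1.2.2⟩, ?_, fun φ hφ hφ0 => ?_⟩
  · filter_upwards [hLE.1.2.1, h] with x hx hxv hxΩ
    rw [← hxv, hx hxΩ]
  · filter_upwards [hLE.2.1, h] with x hx hxv
    rwa [← hxv]
  · refine le_of_eq_of_le ?_ (hLE.2.2 φ hφ hφ0)
    unfold freeEnergy
    have hpow : (fun x => w x ^ q) =ᵐ[volume] fun x => v x ^ q := h.fun_comp (· ^ q)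
    rw [hg, integral_congr_ae (ae_restrict_of_ae hpow)]

/-- universal `L^∞` bound for Lane–Emden densities in terms of `λ₁(Ω,s,2)`. -/
theorem stmt_13 (N : ℕ) (hN : 1 ≤ N) (s : ℝ) (hs : s ∈ Set.Ioo (0 : ℝ) 1)
    (q : ℝ) (hq : q ∈ Set.Ioo (1 : ℝ) 2) :
    ∃ C : ℝ, 0 < C ∧
      ∀ Ω : Set (Euc N), IsOpen Ω → 0 < lambda1 N s 2 Ω →
        ∀ w : Euc N → ℝ, isLaneEmden N s q Ω w →
          eLpNorm w ⊤ (volume.restrict Ω) < ⊤ ∧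
          eLpNorm w ⊤ (volume.restrict Ω) ^ (2 - q) * lambda1 N s 2 Ω ≤ ENNReal.ofReal C := by
  have hC := levelConst_pos N s q
  refine ⟨2 ^ (2 - q) * levelConst N s q, by positivity, fun Ω hΩo hΩ w hLE => ?_⟩
  set v : Euc N → ℝ := fun x => max (w x) 0 with hv
  have hvm : Measurable v := hLE.1.1.max measurable_const
  have hv0 : ∀ x, 0 ≤ v x := fun x => le_max_right _ _
  have hwv : w =ᵐ[volume] v := by
    filter_upwards [hLE.2.1] with x hx
    exact (max_eq_left hx).symm
  have hLEv := hLE.congr_ae hvm hwv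
  rw [eLpNorm_congr_ae (ae_restrict_of_ae hwv)]
  have hint := hLEv.integrableOn_rpow hN hs hq hΩ hv0
  obtain ⟨M, hM⟩ := hLEv.exists_ae_le hs.1 hq hv0 hint
  rw [eLpNorm_exponent_top]
  have hle : ∀ {a : ℝ}, (∀ᵐ x, v x ≤ a) →
      eLpNormEssSup v (volume.restrict Ω) ≤ ENNReal.ofReal a := fun ha =>
    eLpNormEssSup_le_of_ae_bound ((ae_restrict_of_ae ha).mono fun x hx => by
      rwa [Real.norm_of_nonneg (hv0 x)])
  set e := eLpNormEssSup v (volume.restrict Ω) with he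
  have hfin : e < ⊤ := (hle hM).trans_lt ENNReal.ofReal_lt_top
  refine ⟨hfin, ?_⟩
  have h2q : 0 < 2 - q := by linarith [hq.2]
  rcases eq_or_ne e 0 with he0 | he0
  · rw [he0, ENNReal.zero_rpow_of_pos h2q, zero_mul]
    exact zero_le
  obtain ⟨k, hk⟩ : ∃ k, 2 * k = e.toReal := ⟨e.toReal / 2, by ring⟩
  have hk0 : 0 < k := by linarith [ENNReal.toReal_pos he0 hfin.ne]
  have hek : e = ENNReal.ofReal (2 * k) := by rw [hk, ENNReal.ofReal_toReal hfin.ne]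
  have hv2k : ∀ᵐ x, v x ≤ 2 * k := by
    have h1 := (ae_restrict_iff' hΩo.measurableSet).1
      (ae_le_eLpNormEssSup (f := v) (μ := volume.restrict Ω))
    filter_upwards [h1, hLEv.1.2.1] with x hx hx0
    by_cases hxΩ : x ∈ Ω
    · have h2 := hx hxΩ
      rw [← he, hek, Real.enorm_of_nonneg (hv0 x)] at h2
      exact (ENNReal.ofReal_le_ofReal_iff (by positivity)).1 h2
    · rw [hx0 hxΩ]
      positivity
  have hnot : ¬ ∀ᵐ x, v x ≤ k := by
    intro hcon
    have h1 := hle hcon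
    rw [hek, ENNReal.ofReal_le_ofReal_iff hk0.le] at h1
    linarith
  have hlam := hLEv.lambda1_le_of_level hN hs hq hv0 hint hk0 hv2k hnot
  rw [hek, ENNReal.ofReal_rpow_of_pos (by positivity)]
  refine (mul_le_mul' le_rfl hlam).trans_eq ?_
  rw [← ENNReal.ofReal_mul (by positivity)]
  congr 1
  have h3 : k ^ (2 - q) * k ^ (q - 2) = 1 := by
    rw [← Real.rpow_add hk0, show 2 - q + (q - 2) = 0 by ring, Real.rpow_zero]
  rw [Real.mul_rpow two_pos.le hk0.le]
  linear_combination 2 ^ (2 - q) * levelConst N s q * h3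
end
end

section
/- Let q ∈ (1,2), let Ω ⊆ ℝ^N be a nonempty open set, and let w ∈ 𝒦(Ω) be bounded, with w > 0 a.e. in Ω, and a weak solution of the fractional Lane–Emden equation in Ω. Then λ₁(Ω,s,2) ≥ ‖w‖_{L^∞(Ω)}^{q−2}. -/
open MeasureTheory Filter Topology
open scoped ENNReal RealInnerProductSpace

noncomputable section

/-- Discrete Picone inequality. -/
lemma discrete_picone {a b c d : ℝ} (hc : 0 < c) (hd : 0 < d) :
    (c - d) * (a ^ 2 / c - b ^ 2 / d) ≤ (a - b) ^ 2 := by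
  have h : (a - b) ^ 2 - (c - d) * (a ^ 2 / c - b ^ 2 / d) = (a * d - b * c) ^ 2 / (c * d) := by
    field_simp
    ring
  have : 0 ≤ (a * d - b * c) ^ 2 / (c * d) := by positivity
  linarith

lemma sq_div_sub_sq_div_sq_le {a b c d ε n : ℝ} (hε : 0 < ε) (hc : ε ≤ c) (hd : ε ≤ d)
    (ha : 0 ≤ a) (han : a ≤ n) (hb : 0 ≤ b) (hbn : b ≤ n) :
    (a ^ 2 / c - b ^ 2 / d) ^ 2
      ≤ 2 * (2 * n / ε) ^ 2 * (a - b) ^ 2 + 2 * (n ^ 2 / ε ^ 2) ^ 2 * (c - d) ^ 2 := by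
  have hc0 : 0 < c := hε.trans_le hc
  have hd0 : 0 < d := hε.trans_le hd
  have hn : 0 ≤ n := ha.trans han
  have h : a ^ 2 / c - b ^ 2 / d
      = (a + b) / c * (a - b) + b ^ 2 / (c * d) * (d - c) := by
    field_simp
    ring
  have h1 : (a + b) / c ≤ 2 * n / ε := by
    apply div_le_div₀ <;> linarith
  have h2 : b ^ 2 / (c * d) ≤ n ^ 2 / ε ^ 2 := by
    apply div_le_div₀ (by positivity) (by gcongr) (by positivity)
    rw [sq]
    gcongr
  have h1' : ((a + b) / c) ^ 2 ≤ (2 * n / ε) ^ 2 := by gcongr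
  have h2' : (b ^ 2 / (c * d)) ^ 2 ≤ (n ^ 2 / ε ^ 2) ^ 2 := by gcongr
  have h3 := mul_le_mul_of_nonneg_right h1' (sq_nonneg (a - b))
  have h4 := mul_le_mul_of_nonneg_right h2' (sq_nonneg (c - d))
  rw [h]
  nlinarith [sq_nonneg ((a + b) / c * (a - b) - b ^ 2 / (c * d) * (d - c))]

/-- The Gagliardo energy as an integral over the product space. -/
lemma gagliardo_eq_lintegral_prod {N : ℕ} {s : ℝ} {u : Euc N → ℝ} (hu : Measurable u) :
    gagliardo N s u = ∫⁻ p : Euc N × Euc N,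
      ENNReal.ofReal ((u p.1 - u p.2) ^ 2 / ‖p.1 - p.2‖ ^ ((N : ℝ) + 2 * s)) := by
  rw [Measure.volume_eq_prod, lintegral_prod _ (by fun_prop)]
  rfl

lemma abs_min_abs_sub_min_abs_le (a b n : ℝ) : |min |a| n - min |b| n| ≤ |a - b| := by
  refine (abs_min_sub_min_le_max _ _ _ _).trans ?_
  simpa using abs_abs_sub_abs_le a b

/-- If increments of `φ` are controlled by those of `u` and `w`, then `φ` has finite energy. -/
lemma gagliardo_lt_top_of_sq_sub_le {N : ℕ} {s : ℝ} {u w φ : Euc N → ℝ} {A B : ℝ}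
    (hA : 0 ≤ A) (hB : 0 ≤ B) (hu : Measurable u) (hw : Measurable w) (hφ : Measurable φ)
    (hGu : gagliardo N s u < ⊤) (hGw : gagliardo N s w < ⊤)
    (h : ∀ x y, (φ x - φ y) ^ 2 ≤ A * (u x - u y) ^ 2 + B * (w x - w y) ^ 2) :
    gagliardo N s φ < ⊤ := by
  rw [gagliardo_eq_lintegral_prod hφ]
  rw [gagliardo_eq_lintegral_prod hu] at hGu
  rw [gagliardo_eq_lintegral_prod hw] at hGw
  refine lt_of_le_of_lt (b := ENNReal.ofReal A * (∫⁻ p : Euc N × Euc N,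
      ENNReal.ofReal ((u p.1 - u p.2) ^ 2 / ‖p.1 - p.2‖ ^ ((N : ℝ) + 2 * s)))
      + ENNReal.ofReal B * ∫⁻ p : Euc N × Euc N,
      ENNReal.ofReal ((w p.1 - w p.2) ^ 2 / ‖p.1 - p.2‖ ^ ((N : ℝ) + 2 * s))) ?_
    (ENNReal.add_lt_top.2 ⟨ENNReal.mul_lt_top ENNReal.ofReal_lt_top hGu,
      ENNReal.mul_lt_top ENNReal.ofReal_lt_top hGw⟩)
  rw [← lintegral_const_mul _ (by fun_prop), ← lintegral_const_mul _ (by fun_prop),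
    ← lintegral_add_left (by fun_prop)]
  refine lintegral_mono fun p => ?_
  rw [← ENNReal.ofReal_mul hA, ← ENNReal.ofReal_mul hB,
    ← ENNReal.ofReal_add (by positivity) (by positivity)]
  apply ENNReal.ofReal_le_ofReal
  rw [← mul_div_assoc, ← mul_div_assoc, ← add_div]
  gcongr
  exact h p.1 p.2

/-- A form dominated by the energy density of `u` is bounded by the energy of `u`. -/
lemma dform_le_toReal_gagliardo {N : ℕ} {s : ℝ} {u w φ : Euc N → ℝ} (hu : Measurable u)
    (hGu : gagliardo N s u < ⊤)
    (h : ∀ᵐ p : Euc N × Euc N,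
      (w p.1 - w p.2) * (φ p.1 - φ p.2) ≤ (u p.1 - u p.2) ^ 2) :
    dform N s w φ ≤ (gagliardo N s u).toReal := by
  unfold dform
  by_cases hi : Integrable fun p : Euc N × Euc N =>
    (w p.1 - w p.2) * (φ p.1 - φ p.2) / ‖p.1 - p.2‖ ^ ((N : ℝ) + 2 * s)
  · rw [gagliardo_eq_lintegral_prod hu] at hGu ⊢
    have hm : Measurable fun p : Euc N × Euc N =>
      (u p.1 - u p.2) ^ 2 / ‖p.1 - p.2‖ ^ ((N : ℝ) + 2 * s) := by fun_prop
    have h0 : ∀ p : Euc N × Euc N,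
      0 ≤ (u p.1 - u p.2) ^ 2 / ‖p.1 - p.2‖ ^ ((N : ℝ) + 2 * s) := fun p => by positivity
    rw [← integral_eq_lintegral_of_nonneg_ae (.of_forall h0) hm.aestronglyMeasurable]
    refine integral_mono_ae hi
      ((lintegral_ofReal_ne_top_iff_integrable hm.aestronglyMeasurable (.of_forall h0)).1 hGu.ne) ?_
    filter_upwards [h] with p hp
    gcongr
  · rw [integral_undef hi]
    positivity

/-- Testing the Lane–Emden equation with `min(|u|, n)² / (|w| + ε)`. -/
lemma integral_truncation_le {N : ℕ} {s q : ℝ} {Ω : Set (Euc N)} {u w : Euc N → ℝ}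
    (hw0 : ∀ᵐ x, 0 ≤ w x) (hsol : isWeakSolutionLE N s q Ω w) (hu : memK N s Ω u)
    {ε n : ℝ} (hε : 0 < ε) (hn : 0 ≤ n) :
    ∫ x in Ω, |w x| ^ (q - 2) * w x * ((min |u x| n) ^ 2 / (|w x| + ε))
      ≤ (gagliardo N s u).toReal := by
  obtain ⟨⟨hwm, -, hGw⟩, hsol⟩ := hsol
  obtain ⟨hum, hu0, hGu⟩ := hu
  have hφm : Measurable fun x => (min |u x| n) ^ 2 / (|w x| + ε) := by fun_prop
  rw [← hsol (fun x => (min |u x| n) ^ 2 / (|w x| + ε)) ⟨hφm, ?_, ?_⟩]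
  · apply dform_le_toReal_gagliardo hum hGu
    have hq1 := (Measure.quasiMeasurePreserving_fst
      (μ := (volume : Measure (Euc N))) (ν := (volume : Measure (Euc N)))).ae hw0
    have hq2 := (Measure.quasiMeasurePreserving_snd
      (μ := (volume : Measure (Euc N))) (ν := (volume : Measure (Euc N)))).ae hw0
    rw [Measure.volume_eq_prod]
    filter_upwards [hq1, hq2] with p h1 h2
    rw [abs_of_nonneg h1, abs_of_nonneg h2]
    have := discrete_picone (a := min |u p.1| n) (b := min |u p.2| n)
      (c := w p.1 + ε) (d := w p.2 + ε) (by positivity) (by positivity)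
    rw [add_sub_add_right_eq_sub] at this
    exact this.trans (sq_le_sq.2 (abs_min_abs_sub_min_abs_le _ _ _))
  · filter_upwards [hu0] with x hx hxΩ
    simp [hx hxΩ, hn]
  · refine gagliardo_lt_top_of_sq_sub_le (u := u) (w := w) (A := 2 * (2 * n / ε) ^ 2)
      (B := 2 * (n ^ 2 / ε ^ 2) ^ 2) (by positivity) (by positivity) hum hwm hφm hGu hGw ?_
    intro x y
    refine (sq_div_sub_sq_div_sq_le (n := n) hε (by simp) (by simp) (le_min (abs_nonneg _) hn)
      (min_le_right _ _) (le_min (abs_nonneg _) hn) (min_le_right _ _)).trans ?_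
    have h1 := sq_le_sq.2 (abs_min_abs_sub_min_abs_le (u x) (u y) n)
    have h2 := sq_le_sq.2 (abs_abs_sub_abs_le (w x) (w y))
    rw [add_sub_add_right_eq_sub]
    gcongr

/-- Weighted `L²` bound by the energy, for weak solutions bounded by `M`. -/
lemma rpow_mul_integral_sq_le {N : ℕ} {s q : ℝ} (hq : q ∈ Set.Ioo (1 : ℝ) 2) {Ω : Set (Euc N)}
    {u w : Euc N → ℝ} {M : ℝ} (hM : 0 < M) (hw0 : ∀ᵐ x, 0 ≤ w x)
    (hpos : ∀ᵐ x ∂volume.restrict Ω, 0 < w x) (hle : ∀ᵐ x ∂volume.restrict Ω, w x ≤ M)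
    (hsol : isWeakSolutionLE N s q Ω w) (hu : memK N s Ω u)
    (hint : IntegrableOn (fun x => u x ^ 2) Ω) :
    M ^ (q - 2) * ∫ x in Ω, u x ^ 2 ≤ (gagliardo N s u).toReal := by
  have hwm : Measurable w := hsol.1.1
  have hum : Measurable u := hu.1
  have hmin (x : Euc N) (n : ℕ) : (min |u x| n) ^ 2 ≤ u x ^ 2 := by
    rw [← sq_abs (u x)]
    gcongr
    exact min_le_left _ _
  have hlim : Tendsto (fun n : ℕ => ∫ x in Ω,
      (min |u x| n) ^ 2 * (w x / (w x + 1 / ((n : ℝ) + 1)))) atTop (𝓝 (∫ x in Ω, u x ^ 2)) := by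
    refine tendsto_integral_of_dominated_convergence (fun x => u x ^ 2)
      (fun n => by fun_prop) hint (fun n => ?_) ?_
    · filter_upwards [hpos] with x hx
      have h1 : w x / (w x + 1 / ((n : ℝ) + 1)) ≤ 1 := by
        rw [div_le_one (by positivity)]
        have : 0 < 1 / ((n : ℝ) + 1) := by positivity
        linarith
      rw [Real.norm_of_nonneg (by positivity)]
      exact (mul_le_of_le_one_right (by positivity) h1).trans (hmin x n)
    · filter_upwards [hpos] with x hx
      have h1 : Tendsto (fun n : ℕ => (min |u x| n) ^ 2) atTop (𝓝 (u x ^ 2)) := by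
        refine tendsto_const_nhds.congr' ?_
        filter_upwards [eventually_ge_atTop ⌈|u x|⌉₊] with n hn
        rw [min_eq_left (Nat.ceil_le.1 hn), sq_abs]
      have h2 : Tendsto (fun n : ℕ => w x / (w x + 1 / ((n : ℝ) + 1))) atTop
          (𝓝 (w x / (w x + 0))) :=
        tendsto_const_nhds.div (tendsto_const_nhds.add tendsto_one_div_add_atTop_nhds_zero_nat)
          (by simpa using hx.ne')
      rw [add_zero, div_self hx.ne'] at h2
      simpa using h1.mul h2
  refine le_of_tendsto (hlim.const_mul _) (.of_forall fun n => ?_)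
  refine le_trans ?_ (integral_truncation_le hw0 hsol hu
    (ε := 1 / ((n : ℝ) + 1)) (by positivity) n.cast_nonneg)
  set ε : ℝ := 1 / ((n : ℝ) + 1)
  have hε : 0 < ε := by positivity
  rw [← integral_const_mul]
  refine integral_mono_of_nonneg ?_ ?_ ?_
  · filter_upwards [hpos] with x hx
    simp only [Pi.zero_apply]
    positivity
  · refine Integrable.mono' (hint.const_mul (M ^ (q - 1) / ε))
      (Measurable.aestronglyMeasurable (by fun_prop)) ?_
    filter_upwards [hpos, hle] with x hx hxM
    rw [abs_of_pos hx, Real.norm_of_nonneg (by positivity)]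
    have h1 : w x ^ (q - 2) * w x ≤ M ^ (q - 1) := by
      rw [← Real.rpow_add_one hx.ne']
      have : q - 2 + 1 = q - 1 := by ring
      rw [this]
      exact Real.rpow_le_rpow hx.le hxM (by linarith [hq.1])
    calc _ ≤ M ^ (q - 1) * (u x ^ 2 / ε) := by
          exact mul_le_mul h1 (div_le_div₀ (sq_nonneg _) (hmin x n) hε (by linarith))
            (by positivity) (Real.rpow_nonneg hM.le _)
      _ = _ := by ring
  · filter_upwards [hpos, hle] with x hx hxM
    rw [abs_of_pos hx]
    have h1 : M ^ (q - 2) ≤ w x ^ (q - 2) :=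
      Real.rpow_le_rpow_of_nonpos hx hxM (by linarith [hq.2])
    calc _ ≤ w x ^ (q - 2) * ((min |u x| n) ^ 2 * (w x / (w x + ε))) := by gcongr
      _ = _ := by ring

/-- lower bound on `λ₁(Ω,s,2)` from a bounded positive weak solution
of the fractional Lane–Emden equation. -/
theorem stmt_14 (N : ℕ) (hN : 1 ≤ N) (s : ℝ) (hs : s ∈ Set.Ioo (0 : ℝ) 1)
    (q : ℝ) (hq : q ∈ Set.Ioo (1 : ℝ) 2)
    (Ω : Set (Euc N)) (hΩo : IsOpen Ω) (hne : Ω.Nonempty)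
    (w : Euc N → ℝ) (hwK : memK N s Ω w) (hbdd : ∃ M : ℝ, ∀ x, |w x| ≤ M)
    (hpos : ∀ᵐ x ∂volume.restrict Ω, 0 < w x)
    (hsol : isWeakSolutionLE N s q Ω w) :
    eLpNorm w ⊤ (volume.restrict Ω) ^ (q - 2) ≤ lambda1 N s 2 Ω := by
  obtain ⟨M, hM⟩ := hbdd
  have hfin : eLpNorm w ⊤ (volume.restrict Ω) ≠ ⊤ :=
    (memLp_top_of_bound hwK.1.aestronglyMeasurable M (.of_forall hM)).2.ne
  have hw0 : ∀ᵐ x, 0 ≤ w x := by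
    filter_upwards [hwK.2.1, (ae_restrict_iff' hΩo.measurableSet).1 hpos] with x h1 h2
    by_cases hx : x ∈ Ω
    · exact (h2 hx).le
    · exact (h1 hx).ge
  have hle : ∀ᵐ x ∂volume.restrict Ω, w x ≤ (eLpNorm w ⊤ (volume.restrict Ω)).toReal := by
    rw [eLpNorm_exponent_top] at hfin ⊢
    filter_upwards [ae_le_eLpNormEssSup (f := w) (μ := volume.restrict Ω)] with x hx
    have := ENNReal.toReal_mono hfin hx
    rw [toReal_enorm] at this
    exact (le_abs_self _).trans this
  have hΩ : NeBot (ae (volume.restrict Ω)) := by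
    rw [ae_neBot, Ne, Measure.restrict_eq_zero]
    exact (hΩo.measure_pos volume hne).ne'
  obtain ⟨x, hx, hxM⟩ := (hpos.and hle).exists
  have hM0 := hx.trans_le hxM
  refine le_iInf₂ fun u hu => ?_
  obtain ⟨hu, hu1⟩ := hu
  simp only [Real.rpow_two, sq_abs] at hu1
  have hint : IntegrableOn (fun x => u x ^ 2) Ω := by
    by_contra h
    rw [integral_undef h] at hu1
    exact zero_ne_one hu1
  have key := rpow_mul_integral_sq_le hq hM0 hw0 hpos hle hsol hu hint
  rw [hu1, mul_one] at key
  rw [← ENNReal.ofReal_toReal hfin, ENNReal.ofReal_rpow_of_pos hM0]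
  exact ENNReal.ofReal_le_of_le_toReal key
end
end
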